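/- arXiv:1401.7704 — 2 statements merged into one kernel-verified Lean document; each statement's English description precedes it below -/
import Mathlib

section
/- Fix an open interval S = (a,b) and let m_+ be a Herglotz function. Then the following are equivalent: (i) there exists a Herglotz function m_- such that for Lebesgue-a.e. x ∈ (a,b), lim_{y→0+} ( m_+(x+iy) + conj(m_-(x+iy)) ) = 0; (ii) m_+ extends to a holomorphic function M : ℂ⁺ ∪ (a,b) ∪ ℂ⁻ → ℂ⁺ (in particular M takes values in the open upper half plane also on (a,b) and on ℂ⁻). -/
open MeasureTheory Complex Filter Set

noncomputable section

/-- A Herglotz function: a holomorphic map from the open upper half plane to itself. -/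
def IsHerglotz (m : ℂ → ℂ) : Prop :=
  DifferentiableOn ℂ m {z : ℂ | 0 < z.im} ∧ ∀ z : ℂ, 0 < z.im → 0 < (m z).im

/-- The domain `ℂ⁺ ∪ (a,b) ∪ ℂ⁻`. -/
def SlitDomain (a b : ℝ) : Set ℂ := {z : ℂ | z.im ≠ 0 ∨ (a < z.re ∧ z.re < b)}

lemma exists_primitive (U : Set ℂ) (hU : IsOpen U) (hc : Convex ℝ U) (k : ℂ → ℂ)
    (hk : DifferentiableOn ℂ k U) (C : ℝ) (hC : ∀ z ∈ U, ‖k z‖ ≤ C) :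
    ∃ E : ℂ → ℂ, Continuous E ∧ ∀ z ∈ U, HasDerivAt E (k z) z := by
  have h1 : ∃ f : ℂ → ℂ, ∀ z ∈ U, HasFDerivWithinAt f
      (ContinuousLinearMap.toSpanSingleton ℂ (k z)) U z := by
    refine hc.exists_forall_hasFDerivWithinAt_of_hasFDerivWithinAt_symmetric
      (ω := fun z => ContinuousLinearMap.toSpanSingleton ℂ (k z))
      (dω := fun z => ((ContinuousLinearMap.toSpanSingletonCLE (𝕜 := ℂ) (E := ℂ) : ℂ →L[ℂ] (ℂ →L[ℂ] ℂ)).comp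
        (ContinuousLinearMap.toSpanSingleton ℂ (deriv k z))).restrictScalars ℝ) ?_ ?_
    · intro z hz
      have := (hk.differentiableAt (hU.mem_nhds hz)).hasDerivAt.hasFDerivAt
      have h2 := (ContinuousLinearMap.toSpanSingletonCLE (𝕜 := ℂ) (E := ℂ) : ℂ →L[ℂ] (ℂ →L[ℂ] ℂ)).hasFDerivAt.comp z this
      exact (h2.restrictScalars ℝ).hasFDerivWithinAt
    · intro a _ x _ y _
      simp
      ring
  obtain ⟨f, hf⟩ := h1
  have hf' : ∀ z ∈ U, HasDerivWithinAt f (k z) U z := by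
    intro z hz
    have := (hf z hz).hasDerivWithinAt
    simpa using this
  have hlip : LipschitzOnWith C.toNNReal f U := by
    apply hc.lipschitzOnWith_of_nnnorm_hasDerivWithin_le hf'
    intro z hz
    rw [← NNReal.coe_le_coe]
    exact (hC z hz).trans (Real.le_coe_toNNReal C)
  obtain ⟨E, hE, hEq⟩ := hlip.extend_finite_dimension
  refine ⟨E, hE.continuous, fun z hz => ?_⟩
  have := (hf' z hz).hasDerivAt (hU.mem_nhds hz)
  exact this.congr_of_eventuallyEq ((hEq.eventuallyEq_of_mem (hU.mem_nhds hz)).symm)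

lemma intervalIntegrable_of_Ioo {f : ℝ → ℂ} {s t C : ℝ} (hst : s ≤ t)
    (hf : ContinuousOn f (Ioo s t)) (hC : ∀ x ∈ Ioo s t, ‖f x‖ ≤ C) :
    IntervalIntegrable f volume s t := by
  rw [intervalIntegrable_iff_integrableOn_Ioo_of_le hst]
  refine IntegrableOn.of_bound (by simp) (hf.aestronglyMeasurable measurableSet_Ioo) C ?_
  exact (ae_restrict_iff' measurableSet_Ioo).2 (Eventually.of_forall hC)

lemma circleMap_im (c : ℝ) (r θ : ℝ) : (circleMap c r θ).im = r * Real.sin θ := by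
  simp [circleMap, Complex.exp_ofReal_mul_I_im]

lemma circle_upper {c r θ : ℝ} (hr : 0 < r) (h : θ ∈ Ioo 0 Real.pi) :
    0 < (circleMap c r θ).im := by
  rw [circleMap_im]; exact mul_pos hr (Real.sin_pos_of_mem_Ioo h)

lemma circle_lower {c r θ : ℝ} (hr : 0 < r) (h : θ ∈ Ioo Real.pi (2 * Real.pi)) :
    (circleMap c r θ).im < 0 := by
  rw [circleMap_im]
  have : Real.sin θ < 0 := by
    rw [← neg_pos, ← Real.sin_sub_pi]
    apply Real.sin_pos_of_mem_Ioo
    constructor <;> linarith [h.1, h.2]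
  exact mul_neg_of_pos_of_neg hr this

lemma circ_half_integrable {k : ℂ → ℂ} {c r : ℝ} {C : ℝ}
    (hk : DifferentiableOn ℂ k {z : ℂ | z.im ≠ 0}) (hC : ∀ z : ℂ, z.im ≠ 0 → ‖k z‖ ≤ C)
    {s t : ℝ} (hst : s ≤ t) (h : ∀ θ ∈ Ioo s t, (circleMap c r θ).im ≠ 0) :
    IntervalIntegrable (fun θ => k (circleMap c r θ)) volume s t := by
  apply intervalIntegrable_of_Ioo (C := C) hst
  · exact hk.continuousOn.comp (continuous_circleMap _ _).continuousOn h
  · exact fun θ hθ => hC _ (h θ hθ)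

lemma circ_integrable {k : ℂ → ℂ} {c r : ℝ} (hr : 0 < r) {C : ℝ}
    (hk : DifferentiableOn ℂ k {z : ℂ | z.im ≠ 0}) (hC : ∀ z : ℂ, z.im ≠ 0 → ‖k z‖ ≤ C) :
    CircleIntegrable k c r :=
  (circ_half_integrable hk hC Real.pi_pos.le fun _ h => (circle_upper hr h).ne').trans
    (circ_half_integrable hk hC (by linarith [Real.pi_pos]) fun _ h => (circle_lower hr h).ne)

lemma half_circle_integral {k E : ℂ → ℂ} {c r : ℝ} {C : ℝ}
    (hk : DifferentiableOn ℂ k {z : ℂ | z.im ≠ 0}) (hC : ∀ z : ℂ, z.im ≠ 0 → ‖k z‖ ≤ C)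
    {s t : ℝ} (hst : s ≤ t) (h : ∀ θ ∈ Ioo s t, (circleMap c r θ).im ≠ 0)
    (hE : Continuous E) (hd : ∀ θ ∈ Ioo s t, HasDerivAt E (k (circleMap c r θ)) (circleMap c r θ)) :
    IntervalIntegrable (fun θ => deriv (circleMap c r) θ • k (circleMap c r θ)) volume s t ∧
    ∫ θ in s..t, deriv (circleMap c r) θ • k (circleMap c r θ) =
      E (circleMap c r t) - E (circleMap c r s) := by
  have hi : IntervalIntegrable (fun θ => deriv (circleMap c r) θ • k (circleMap c r θ))
      volume s t := by
    have := (circ_half_integrable hk hC hst h).continuousOn_mul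
      (g := fun θ => circleMap 0 r θ * I)
      ((continuous_circleMap _ _).mul continuous_const).continuousOn
    simpa [deriv_circleMap] using this
  refine ⟨hi, ?_⟩
  refine intervalIntegral.integral_eq_sub_of_hasDerivAt_of_le hst
    (hE.comp (continuous_circleMap _ _)).continuousOn (fun θ hθ => ?_) hi
  have := (hd θ hθ).comp_of_eq θ (hasDerivAt_circleMap c r θ) rfl
  rw [deriv_circleMap, smul_eq_mul, mul_comm]
  exact this

lemma horiz {E k : ℂ → ℂ} {y p q : ℝ} (hpq : p ≤ q)
    (hk : DifferentiableOn ℂ k {z : ℂ | z.im ≠ 0})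
    (hd : ∀ x : ℝ, HasDerivAt E (k (x + y * I)) (x + y * I)) (hy : y ≠ 0) :
    IntervalIntegrable (fun x : ℝ => k (x + y * I)) volume p q ∧
    ∫ x in p..q, k ((x : ℂ) + y * I) = E (q + y * I) - E (p + y * I) := by
  have hcont : Continuous (fun x : ℝ => k (x + y * I)) := by
    rw [← continuousOn_univ]
    refine hk.continuousOn.comp (t := {z : ℂ | z.im ≠ 0}) (by fun_prop) ?_
    intro x _
    simpa using hy
  refine ⟨hcont.intervalIntegrable _ _, ?_⟩
  refine intervalIntegral.integral_eq_sub_of_hasDerivAt (f := fun x : ℝ => E (x + y * I)) ?_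
    (hcont.intervalIntegrable _ _)
  intro x _
  have h1 : HasDerivAt (fun x : ℝ => (x : ℂ) + y * I) 1 x :=
    (ofRealCLM.hasDerivAt (x := x)).add_const _
  have h2 := (hd x).comp_of_eq x h1 rfl
  rw [mul_one] at h2
  exact h2

lemma circle_zero {k : ℂ → ℂ} {a b c r : ℝ} (hr : 0 < r) (ha : a < c - r) (hb : c + r < b) {C : ℝ}
    (hk : DifferentiableOn ℂ k {z : ℂ | z.im ≠ 0}) (hC : ∀ z : ℂ, z.im ≠ 0 → ‖k z‖ ≤ C)
    (hj : ∀ᵐ x : ℝ, x ∈ Set.Ioo a b →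
      Tendsto (fun y : ℝ => k (x + y * I) - k (x + (-y : ℝ) * I)) (nhdsWithin 0 (Ioi 0)) (nhds 0)) :
    (∮ z in C(c, r), k z) = 0 := by
  obtain ⟨E, hE, hEd⟩ := exists_primitive {z : ℂ | 0 < z.im}
    (isOpen_lt continuous_const continuous_im) (convex_halfSpace_im_gt 0) k
    (hk.mono fun z hz => ne_of_gt hz) C (fun z hz => hC z (ne_of_gt hz))
  obtain ⟨F, hF, hFd⟩ := exists_primitive {z : ℂ | z.im < 0}
    (isOpen_lt continuous_im continuous_const) (convex_halfSpace_im_lt 0) k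
    (hk.mono fun z hz => ne_of_lt hz) C (fun z hz => hC z (ne_of_lt hz))
  obtain ⟨i1, e1⟩ := half_circle_integral (c := c) (r := r) hk hC Real.pi_pos.le
    (fun _ h => (circle_upper hr h).ne') hE (fun θ h => hEd _ (circle_upper hr h))
  obtain ⟨i2, e2⟩ := half_circle_integral (c := c) (r := r) (s := Real.pi) (t := 2 * Real.pi)
    hk hC (by linarith [Real.pi_pos])
    (fun _ h => (circle_lower hr h).ne) hF (fun θ h => hFd _ (circle_lower hr h))
  rw [circleIntegral, ← intervalIntegral.integral_add_adjacent_intervals i1 i2, e1, e2]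
  have c0 : circleMap c r 0 = ((c + r : ℝ) : ℂ) := by simp [circleMap]
  have cpi : circleMap c r Real.pi = ((c - r : ℝ) : ℂ) := by simp [circleMap]; ring
  have c2 : circleMap c r (2 * Real.pi) = ((c + r : ℝ) : ℂ) := by simp [circleMap]
  rw [c0, cpi, c2]
  set p := c - r
  set q := c + r
  have hpq : p ≤ q := by simp only [p, q]; linarith
  -- the horizontal integrals
  have hlim1 : Tendsto (fun y : ℝ => ∫ x in p..q, (k ((x : ℂ) + y * I) - k (x + (-y : ℝ) * I)))
      (nhdsWithin 0 (Ioi 0)) (nhds (∫ x in p..q, (0 : ℂ))) := by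
    refine intervalIntegral.tendsto_integral_filter_of_dominated_convergence (fun _ => C + C)
      ?_ ?_ (by simp) ?_
    · filter_upwards [self_mem_nhdsWithin] with y hy
      have hy' : 0 < y := hy
      have h1 := (horiz (y := y) hpq hk (fun x => hEd _ (by simpa using hy')) hy'.ne').1
      have h2 := (horiz (y := -y) hpq hk (fun x => hFd _ (by simpa using hy')) (by linarith [hy'])).1
      exact (intervalIntegrable_iff.1 (h1.sub h2)).aestronglyMeasurable
    · filter_upwards [self_mem_nhdsWithin] with y hy
      have hy' : 0 < y := hy
      refine Eventually.of_forall fun x _ => ?_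
      refine (norm_sub_le _ _).trans (add_le_add (hC _ ?_) (hC _ ?_))
      · simpa using hy'.ne'
      · simpa using hy'.ne'
    · filter_upwards [hj] with x hx hxm
      rw [uIoc_of_le hpq] at hxm
      exact hx ⟨by linarith [hxm.1], by linarith [hxm.2]⟩
  have hlim2 : Tendsto (fun y : ℝ => (E ((q : ℂ) + y * I) - E (p + y * I)) -
      (F ((q : ℂ) + (-y : ℝ) * I) - F (p + (-y : ℝ) * I)))
      (nhdsWithin 0 (Ioi 0)) (nhds ((E q - E p) - (F q - F p))) := by
    have : Continuous (fun y : ℝ => (E ((q : ℂ) + y * I) - E (p + y * I)) -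
      (F ((q : ℂ) + (-y : ℝ) * I) - F (p + (-y : ℝ) * I))) := by fun_prop
    have h := (this.tendsto 0).mono_left (nhdsWithin_le_nhds (s := Ioi 0))
    simpa using h
  have heq : (fun y : ℝ => ∫ x in p..q, (k ((x : ℂ) + y * I) - k (x + (-y : ℝ) * I)))
      =ᶠ[nhdsWithin 0 (Ioi 0)] (fun y : ℝ => (E ((q : ℂ) + y * I) - E (p + y * I)) -
      (F ((q : ℂ) + (-y : ℝ) * I) - F (p + (-y : ℝ) * I))) := by
    filter_upwards [self_mem_nhdsWithin] with y hy
    have hy' : 0 < y := hy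
    have h1 := (horiz (y := y) hpq hk (fun x => hEd _ (by simpa using hy')) hy'.ne')
    have h2 := (horiz (y := -y) hpq hk (fun x => hFd _ (by simpa using hy')) (by linarith [hy']))
    rw [intervalIntegral.integral_sub h1.1 h2.1, h1.2, h2.2]
  have := tendsto_nhds_unique (hlim1.congr' heq) hlim2
  simp only [intervalIntegral.integral_zero] at this
  linear_combination this

lemma cauchy_formula {g : ℂ → ℂ} {a b c r : ℝ} (hr : 0 < r) (ha : a < c - r) (hb : c + r < b)
    (hg : DifferentiableOn ℂ g {z : ℂ | z.im ≠ 0}) (hC : ∀ z : ℂ, z.im ≠ 0 → ‖g z‖ ≤ 1)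
    (hj : ∀ᵐ x : ℝ, x ∈ Set.Ioo a b →
      Tendsto (fun y : ℝ => g (x + y * I) - g (x + (-y : ℝ) * I)) (nhdsWithin 0 (Ioi 0)) (nhds 0))
    (z : ℂ) (hz : z.im ≠ 0) (hzb : z ∈ Metric.ball (c : ℂ) r) :
    (2 * Real.pi * I : ℂ)⁻¹ • (∮ w in C(c, r), (w - z)⁻¹ • g w) = g z := by
  have hopen : IsOpen {z : ℂ | z.im ≠ 0} := isOpen_ne_fun continuous_im continuous_const
  have hkd : DifferentiableOn ℂ (dslope g z) {z : ℂ | z.im ≠ 0} :=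
    (Complex.differentiableOn_dslope (hopen.mem_nhds hz)).2 hg
  have hkb : ∃ C, ∀ w : ℂ, w.im ≠ 0 → ‖dslope g z w‖ ≤ C := by
    obtain ⟨ρ, hρ, hsub⟩ := Metric.nhds_basis_closedBall.mem_iff.1 (hopen.mem_nhds hz)
    obtain ⟨C, hC'⟩ := (isCompact_closedBall z ρ).exists_bound_of_continuousOn
      (hkd.continuousOn.mono hsub)
    refine ⟨max C (2 / ρ), fun w hw => ?_⟩
    by_cases h : w ∈ Metric.closedBall z ρ
    · exact (hC' w h).trans (le_max_left _ _)
    · refine le_trans ?_ (le_max_right _ _)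
      rw [Metric.mem_closedBall, not_le, dist_eq_norm] at h
      have hne : w ≠ z := by
        rintro rfl
        simp at h
        linarith
      rw [dslope_of_ne _ hne, slope_def_field, norm_div]
      have h2 : ‖g w - g z‖ ≤ 2 := by
        linarith [norm_sub_le (g w) (g z), hC w hw, hC z hz]
      gcongr
  obtain ⟨C, hkC⟩ := hkb
  have hkj : ∀ᵐ x : ℝ, x ∈ Set.Ioo a b →
      Tendsto (fun y : ℝ => dslope g z (x + y * I) - dslope g z (x + (-y : ℝ) * I))
        (nhdsWithin 0 (Ioi 0)) (nhds 0) := by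
    filter_upwards [hj] with x hx hxm
    have hxz : (x : ℂ) - z ≠ 0 := by
      intro h
      apply hz
      have := congrArg Complex.im h
      simpa using this
    have t1 : Tendsto (fun y : ℝ => ((x : ℂ) + y * I - z)⁻¹) (nhdsWithin 0 (Ioi 0))
        (nhds ((x : ℂ) - z)⁻¹) := by
      have : ContinuousAt (fun y : ℝ => ((x : ℂ) + y * I - z)⁻¹) 0 := by
        apply ContinuousAt.inv₀ (by fun_prop)
        simpa using hxz
      have h := this.tendsto.mono_left (nhdsWithin_le_nhds (s := Ioi 0))
      simpa using h
    have t2 : Tendsto (fun y : ℝ => ((x : ℂ) + (-y : ℝ) * I - z)⁻¹) (nhdsWithin 0 (Ioi 0))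
        (nhds ((x : ℂ) - z)⁻¹) := by
      have : ContinuousAt (fun y : ℝ => ((x : ℂ) + (-y : ℝ) * I - z)⁻¹) 0 := by
        apply ContinuousAt.inv₀ (by fun_prop)
        simpa using hxz
      have h := this.tendsto.mono_left (nhdsWithin_le_nhds (s := Ioi 0))
      simpa using h
    have t3 : Tendsto (fun y : ℝ => (g (x + y * I) - g (x + (-y : ℝ) * I)) *
        ((x : ℂ) + y * I - z)⁻¹) (nhdsWithin 0 (Ioi 0)) (nhds 0) := by
      simpa using (hx hxm).mul t1
    have t4 : Tendsto (fun y : ℝ => (g (x + (-y : ℝ) * I) - g z) *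
        (((x : ℂ) + y * I - z)⁻¹ - ((x : ℂ) + (-y : ℝ) * I - z)⁻¹))
        (nhdsWithin 0 (Ioi 0)) (nhds 0) := by
      have h0 := t1.sub t2
      rw [sub_self] at h0
      have h3 := h0.norm.const_mul 2
      rw [norm_zero, mul_zero] at h3
      refine squeeze_zero_norm' ?_ h3
      filter_upwards [self_mem_nhdsWithin] with y hy
      have hy' : 0 < y := hy
      rw [norm_mul]
      refine mul_le_mul_of_nonneg_right ?_ (norm_nonneg _)
      have := hC ((x : ℂ) + (-y : ℝ) * I) (by simpa using hy'.ne')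
      linarith [norm_sub_le (g (x + (-y : ℝ) * I)) (g z), hC z hz]
    have t5 := t3.add t4
    rw [add_zero] at t5
    refine t5.congr' ?_
    have hev : ∀ᶠ y : ℝ in nhdsWithin 0 (Ioi 0),
        (x : ℂ) + y * I ≠ z ∧ (x : ℂ) + (-y : ℝ) * I ≠ z := by
      have h1 : ∀ᶠ y : ℝ in nhds 0, (x : ℂ) + y * I ≠ z :=
        ContinuousAt.eventually_ne (g := fun y : ℝ => (x : ℂ) + y * I) (by fun_prop)
          (by simpa [sub_eq_zero] using hxz)
      have h2 : ∀ᶠ y : ℝ in nhds 0, (x : ℂ) + (-y : ℝ) * I ≠ z :=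
        ContinuousAt.eventually_ne (g := fun y : ℝ => (x : ℂ) + (-y : ℝ) * I) (by fun_prop)
          (by simpa [sub_eq_zero] using hxz)
      exact (h1.and h2).filter_mono nhdsWithin_le_nhds
    filter_upwards [hev] with y hy
    rw [dslope_of_ne _ hy.1, dslope_of_ne _ hy.2, slope_def_field, slope_def_field]
    simp only [div_eq_mul_inv]
    ring
  have hzero := circle_zero hr ha hb hkd hkC hkj
  have hne : ∀ w ∈ Metric.sphere (c : ℂ) r, w - z ≠ 0 := by
    intro w hw h
    rw [sub_eq_zero] at h
    subst h
    simp only [Metric.mem_sphere, Metric.mem_ball] at hw hzb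
    linarith
  have hinvc : ContinuousOn (fun w : ℂ => (w - z)⁻¹) (Metric.sphere (c : ℂ) r) :=
    ContinuousOn.inv₀ (by fun_prop) hne
  have hI2 : CircleIntegrable (fun w : ℂ => (w - z)⁻¹ * g z) c r :=
    (hinvc.mul continuousOn_const).circleIntegrable hr.le
  have hgI : CircleIntegrable g c r := circ_integrable hr hg hC
  have hI1 : CircleIntegrable (fun w : ℂ => (w - z)⁻¹ • g w) c r := by
    refine IntervalIntegrable.continuousOn_mul hgI ?_
    refine hinvc.comp (continuous_circleMap _ _).continuousOn ?_
    intro θ _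
    exact circleMap_mem_sphere _ hr.le _
  have hcongr : (∮ w in C(c, r), dslope g z w) =
      ∮ w in C(c, r), ((w - z)⁻¹ • g w - (w - z)⁻¹ * g z) := by
    refine circleIntegral.integral_congr hr.le fun w hw => ?_
    have := hne w hw
    rw [dslope_of_ne _ (sub_ne_zero.1 this), slope_def_field]
    simp only [smul_eq_mul, div_eq_mul_inv]
    ring
  rw [hcongr, circleIntegral.integral_sub hI1 hI2, sub_eq_zero] at hzero
  rw [hzero]
  have : (∮ w in C(c, r), (w - z)⁻¹ * g z) = (2 * Real.pi * I) * g z := by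
    have h := circleIntegral.integral_smul_const (fun w : ℂ => (w - z)⁻¹) (g z) c r
    rw [circleIntegral.integral_sub_inv_of_mem_ball hzb] at h
    simpa using h
  rw [this, smul_eq_mul, inv_mul_cancel_left₀ Complex.two_pi_I_ne_zero]

lemma neBot_offreal (x : ℂ) : (nhdsWithin x {z : ℂ | z.im ≠ 0}).NeBot := by
  rw [← mem_closure_iff_nhdsWithin_neBot, Metric.mem_closure_iff]
  intro ε hε
  by_cases h : x.im = 0
  · refine ⟨x + (ε / 2 : ℝ) * I, ?_, ?_⟩
    · simp [h, hε.ne']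
    · rw [dist_eq_norm]
      simp [abs_of_pos hε]
      linarith
  · exact ⟨x, h, by simpa using hε⟩

lemma extension {g : ℂ → ℂ} {a b : ℝ}
    (hg : DifferentiableOn ℂ g {z : ℂ | z.im ≠ 0}) (hC : ∀ z : ℂ, z.im ≠ 0 → ‖g z‖ < 1)
    (hj : ∀ᵐ x : ℝ, x ∈ Set.Ioo a b →
      Tendsto (fun y : ℝ => g (x + y * I) - g (x + (-y : ℝ) * I))
        (nhdsWithin 0 (Ioi 0)) (nhds 0)) :
    ∃ G : ℂ → ℂ, DifferentiableOn ℂ G (SlitDomain a b) ∧ (∀ z ∈ SlitDomain a b, ‖G z‖ < 1) ∧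
      ∀ z : ℂ, z.im ≠ 0 → G z = g z := by
  classical
  have hopen : IsOpen {z : ℂ | z.im ≠ 0} := isOpen_ne_fun continuous_im continuous_const
  set G : ℂ → ℂ := fun z => limUnder (nhdsWithin z {z : ℂ | z.im ≠ 0}) g with hG
  have hGg : ∀ z : ℂ, z.im ≠ 0 → G z = g z := by
    intro z hz
    have := neBot_offreal z
    exact (hg.continuousOn z hz).tendsto.limUnder_eq
  have hSopen : IsOpen (SlitDomain a b) := by
    have : SlitDomain a b = {z : ℂ | z.im ≠ 0} ∪ ({z : ℂ | a < z.re} ∩ {z : ℂ | z.re < b}) := by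
      ext z; simp [SlitDomain]
    rw [this]
    exact hopen.union ((isOpen_lt continuous_const continuous_re).inter
      (isOpen_lt continuous_re continuous_const))
  have hdiff : ∀ z ∈ SlitDomain a b, DifferentiableAt ℂ G z := by
    intro z hz
    by_cases hzi : z.im = 0
    · have hz' : a < z.re ∧ z.re < b := hz.resolve_left (not_not.2 hzi)
      set c := z.re with hc
      have hzc : z = (c : ℂ) := by
        apply Complex.ext <;> simp [hc, hzi]
      obtain ⟨r, hr, hr1, hr2⟩ : ∃ r : ℝ, 0 < r ∧ a < c - r ∧ c + r < b := by
        refine ⟨min (c - a) (b - c) / 2, ?_, ?_, ?_⟩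
        · have := lt_min (sub_pos.2 hz'.1) (sub_pos.2 hz'.2)
          linarith
        · have := min_le_left (c - a) (b - c)
          linarith
        · have := min_le_right (c - a) (b - c)
          linarith
      have hgI : CircleIntegrable g c r := circ_integrable hr hg (fun z hz => (hC z hz).le)
      have hps := hasFPowerSeriesOn_cauchy_integral (R := NNReal.mk r hr.le) hgI hr
      set h : ℂ → ℂ := fun w => (2 * Real.pi * I : ℂ)⁻¹ • ∮ z in C(c, r), (z - w)⁻¹ • g z with hh
      have hd : DifferentiableOn ℂ h (Metric.ball (c : ℂ) r) := by
        refine hps.differentiableOn.mono fun w hw => ?_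
        rw [Metric.mem_ball] at hw
        rw [Metric.mem_eball, edist_lt_coe, ← NNReal.coe_lt_coe, coe_nndist]
        exact hw
      have hheq : ∀ w ∈ Metric.ball (c : ℂ) r, w.im ≠ 0 → h w = g w := fun w hw hwi =>
        cauchy_formula hr hr1 hr2 hg (fun z hz => (hC z hz).le) hj w hwi hw
      have hGh : EqOn G h (Metric.ball (c : ℂ) r) := by
        intro w hw
        have hnb := Metric.isOpen_ball.mem_nhds hw
        have := neBot_offreal w
        have hcont : ContinuousAt h w := (hd.differentiableAt hnb).continuousAt
        have ht : Tendsto g (nhdsWithin w {z : ℂ | z.im ≠ 0}) (nhds (h w)) := by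
          refine (hcont.tendsto.mono_left nhdsWithin_le_nhds).congr' ?_
          filter_upwards [self_mem_nhdsWithin, nhdsWithin_le_nhds hnb] with v hv hvb
          exact hheq v hvb hv
        exact ht.limUnder_eq
      have hcb : (c : ℂ) ∈ Metric.ball (c : ℂ) r := Metric.mem_ball_self hr
      have hnb := Metric.isOpen_ball.mem_nhds hcb
      rw [hzc]
      exact (hd.differentiableAt hnb).congr_of_eventuallyEq (hGh.eventuallyEq_of_mem hnb)
    · refine (hg.differentiableAt (hopen.mem_nhds hzi)).congr_of_eventuallyEq ?_
      filter_upwards [hopen.mem_nhds hzi] with w hw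
      exact hGg w hw
  have hle : ∀ z ∈ SlitDomain a b, ‖G z‖ ≤ 1 := by
    intro z hz
    have := neBot_offreal z
    have ht := ((hdiff z hz).continuousAt.tendsto.mono_left
      (nhdsWithin_le_nhds (s := {z : ℂ | z.im ≠ 0}))).norm
    refine le_of_tendsto ht ?_
    filter_upwards [self_mem_nhdsWithin] with w hw
    rw [hGg w hw]
    exact (hC w hw).le
  refine ⟨G, fun z hz => (hdiff z hz).differentiableWithinAt, fun z hz => ?_, hGg⟩
  by_contra hcon
  rw [not_lt] at hcon
  have hmax : IsLocalMax (norm ∘ G) z := by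
    filter_upwards [hSopen.mem_nhds hz] with w hw
    exact (hle w hw).trans hcon
  have hev := Complex.eventually_eq_of_isLocalMax_norm
    (by filter_upwards [hSopen.mem_nhds hz] with w hw using hdiff w hw) hmax
  have := neBot_offreal z
  obtain ⟨w, hw, hwi⟩ := ((hev.filter_mono (nhdsWithin_le_nhds (s := {z : ℂ | z.im ≠ 0}))).and
    self_mem_nhdsWithin).exists
  have h1 := hC w hwi
  rw [← hGg w hwi, hw] at h1
  linarith

lemma norm_cayley {w : ℂ} (hw : 0 < w.im) : w + I ≠ 0 ∧ 1 ≤ ‖w + I‖ ∧ ‖(w - I) / (w + I)‖ < 1 := by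
  have h1 : 1 ≤ ‖w + I‖ := by
    have := Complex.abs_im_le_norm (w + I)
    simp only [add_im, I_im] at this
    rw [abs_of_pos (by linarith)] at this
    linarith
  have h0 : w + I ≠ 0 := by
    intro h
    rw [h, norm_zero] at h1
    linarith
  refine ⟨h0, h1, ?_⟩
  rw [norm_div, div_lt_one (by linarith), ← sq_lt_sq₀ (norm_nonneg _) (norm_nonneg _),
    Complex.sq_norm, Complex.sq_norm, normSq_apply, normSq_apply]
  simp
  nlinarith

lemma im_cayley_inv {w : ℂ} (hw : ‖w‖ < 1) : 1 - w ≠ 0 ∧ 0 < (I * (1 + w) / (1 - w)).im := by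
  have h0 : 1 - w ≠ 0 := by
    intro h
    rw [sub_eq_zero] at h
    rw [← h] at hw
    simp at hw
  refine ⟨h0, ?_⟩
  have hn : 0 < normSq (1 - w) := normSq_pos.2 h0
  have hw2 : normSq w < 1 := by
    rw [← Complex.sq_norm]
    nlinarith [norm_nonneg w]
  have : (I * (1 + w) / (1 - w)).im = (1 - normSq w) / normSq (1 - w) := by
    rw [Complex.div_im]
    simp [normSq_apply]
    ring
  rw [this]
  exact div_pos (by linarith) hn

theorem conj_diff {f : ℂ → ℂ} {z : ℂ} (hf : DifferentiableAt ℂ f (starRingEnd ℂ z)) :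
    DifferentiableAt ℂ (fun z => starRingEnd ℂ (f (starRingEnd ℂ z))) z := by
  have := hf.conj_conj
  simpa [Function.comp_def] using this

/-- Lemma 1.1 (Lemma 2.1): for an open interval `S = (a,b)` and a Herglotz function `m₊`,
the reflectionless condition `m₊(x) = -conj(m₋(x))` for a.e. `x ∈ (a,b)` (for some Herglotz
`m₋`) holds if and only if `m₊` has a holomorphic continuation
`M : ℂ⁺ ∪ (a,b) ∪ ℂ⁻ → ℂ⁺`. -/
theorem statement5 (a b : ℝ) (hab : a < b) (mp : ℂ → ℂ) (hmp : IsHerglotz mp) :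
    (∃ mm : ℂ → ℂ, IsHerglotz mm ∧
      ∀ᵐ x : ℝ, x ∈ Set.Ioo a b →
        Tendsto (fun y : ℝ => mp (↑x + ↑y * I) + starRingEnd ℂ (mm (↑x + ↑y * I)))
          (nhdsWithin 0 (Set.Ioi 0)) (nhds 0)) ↔
    (∃ M : ℂ → ℂ, DifferentiableOn ℂ M (SlitDomain a b) ∧
      (∀ z ∈ SlitDomain a b, 0 < (M z).im) ∧
      ∀ z : ℂ, 0 < z.im → M z = mp z) := by
  constructor
  · rintro ⟨mm, hmm, hlim⟩
    have hUo : IsOpen {z : ℂ | 0 < z.im} := isOpen_lt continuous_const continuous_im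
    have hLo : IsOpen {z : ℂ | z.im < 0} := isOpen_lt continuous_im continuous_const
    set N : ℂ → ℂ := fun z => if 0 < z.im then mp z else
      -starRingEnd ℂ (mm (starRingEnd ℂ z)) with hN
    have hNu : ∀ z : ℂ, 0 < z.im → N z = mp z := fun z hz => if_pos hz
    have hNl : ∀ z : ℂ, z.im < 0 → N z = -starRingEnd ℂ (mm (starRingEnd ℂ z)) :=
      fun z hz => if_neg (not_lt.2 hz.le)
    have hNim : ∀ z : ℂ, z.im ≠ 0 → 0 < (N z).im := by
      intro z hz
      rcases lt_or_gt_of_ne hz with h | h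
      · rw [hNl z h]
        simpa using hmm.2 (starRingEnd ℂ z) (by simpa using h)
      · rw [hNu z h]
        exact hmp.2 z h
    have hNd : ∀ z : ℂ, z.im ≠ 0 → DifferentiableAt ℂ N z := by
      intro z hz
      rcases lt_or_gt_of_ne hz with h | h
      · have h1 : DifferentiableAt ℂ mm (starRingEnd ℂ z) :=
          hmm.1.differentiableAt (hUo.mem_nhds (by simpa using h))
        refine (conj_diff h1).neg.congr_of_eventuallyEq ?_
        filter_upwards [hLo.mem_nhds h] with w hw
        exact hNl w hw
      · refine (hmp.1.differentiableAt (hUo.mem_nhds h)).congr_of_eventuallyEq ?_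
        filter_upwards [hUo.mem_nhds h] with w hw
        exact hNu w hw
    obtain ⟨G, hGd, hGn, hGg⟩ := extension (g := fun z => (N z - I) / (N z + I)) (a := a) (b := b)
      (fun z hz => (((hNd z hz).sub_const I).div ((hNd z hz).add_const I)
        (norm_cayley (hNim z hz)).1).differentiableWithinAt)
      (fun z hz => (norm_cayley (hNim z hz)).2.2)
      (by
        filter_upwards [hlim] with x hx hxm
        have h1 := (hx hxm).norm.const_mul 2
        rw [norm_zero, mul_zero] at h1
        refine squeeze_zero_norm' ?_ h1
        filter_upwards [self_mem_nhdsWithin] with y hy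
        have hy' : 0 < y := hy
        have hiu : 0 < ((x : ℂ) + y * I).im := by simpa using hy'
        have hil : ((x : ℂ) + (-y : ℝ) * I).im < 0 := by simpa using hy'
        obtain ⟨p1, p2, -⟩ := norm_cayley (hNim _ hiu.ne')
        obtain ⟨q1, q2, -⟩ := norm_cayley (hNim _ hil.ne)
        have e1 := hNu _ hiu
        have e2 := hNl _ hil
        have e3 : starRingEnd ℂ ((x : ℂ) + (-y : ℝ) * I) = x + y * I := by
          simp
        rw [e3] at e2
        have e4 : mp (↑x + ↑y * I) + starRingEnd ℂ (mm (↑x + ↑y * I)) =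
            N (x + y * I) - N (x + (-y : ℝ) * I) := by
          rw [e1, e2]; ring
        rw [e4]
        generalize N (x + y * I) = u at *
        generalize N (x + (-y : ℝ) * I) = v at *
        have e5 : (u - I) / (u + I) - (v - I) / (v + I) =
            2 * I * (u - v) / ((u + I) * (v + I)) := by
          field_simp
          ring
        rw [e5, norm_div, norm_mul, norm_mul, norm_mul]
        simp only [Complex.norm_I, Complex.norm_ofNat, mul_one]
        apply div_le_self (by positivity)
        nlinarith)
    refine ⟨fun z => I * (1 + G z) / (1 - G z), ?_, ?_, ?_⟩
    · intro z hz
      exact ((hGd z hz).const_add 1 |>.const_mul I).div ((hGd z hz).const_sub 1)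
        (im_cayley_inv (hGn z hz)).1
    · intro z hz
      exact (im_cayley_inv (hGn z hz)).2
    · intro z hz
      have hG := hGg z hz.ne'
      simp only [hNu z hz] at hG
      have h1 := (norm_cayley (hmp.2 z hz)).1
      have h2 := (im_cayley_inv (hGn z (Or.inl hz.ne'))).1
      rw [div_eq_iff h2, hG]
      field_simp
      ring
  · rintro ⟨M, hMd, hMi, hM⟩
    have hLo : IsOpen {z : ℂ | z.im < 0} := isOpen_lt continuous_im continuous_const
    refine ⟨fun z => -starRingEnd ℂ (M (starRingEnd ℂ z)), ⟨?_, ?_⟩, ?_⟩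
    · intro z hz
      have hz' : (starRingEnd ℂ z).im < 0 := by simpa using hz
      have h1 : DifferentiableAt ℂ M (starRingEnd ℂ z) := by
        refine hMd.differentiableAt ?_
        filter_upwards [hLo.mem_nhds hz'] with w hw
        exact Or.inl (ne_of_lt hw)
      exact (conj_diff h1).neg.differentiableWithinAt
    · intro z hz
      have := hMi (starRingEnd ℂ z) (Or.inl (by simpa using hz.ne'))
      simpa using this
    · refine Eventually.of_forall fun x hx => ?_
      have hxS : SlitDomain a b ∈ nhds (x : ℂ) := by
        have ho : IsOpen ({z : ℂ | a < z.re} ∩ {z : ℂ | z.re < b}) :=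
          (isOpen_lt continuous_const continuous_re).inter
            (isOpen_lt continuous_re continuous_const)
        filter_upwards [ho.mem_nhds (show (x : ℂ) ∈ _ by simpa using hx)] with w hw
        exact Or.inr hw
      have hc : ContinuousAt M (x : ℂ) := (hMd.differentiableAt hxS).continuousAt
      have t1 : Tendsto (fun y : ℝ => M ((x : ℂ) + y * I)) (nhdsWithin 0 (Ioi 0))
          (nhds (M x)) := by
        refine hc.tendsto.comp (Tendsto.mono_left ?_ nhdsWithin_le_nhds)
        have : Continuous (fun y : ℝ => (x : ℂ) + y * I) := by fun_prop
        simpa using this.tendsto 0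
      have t2 : Tendsto (fun y : ℝ => M ((x : ℂ) + -(y * I))) (nhdsWithin 0 (Ioi 0))
          (nhds (M x)) := by
        refine hc.tendsto.comp (Tendsto.mono_left ?_ nhdsWithin_le_nhds)
        have : Continuous (fun y : ℝ => (x : ℂ) + -(y * I)) := by fun_prop
        simpa using this.tendsto 0
      have t3 := t1.sub t2
      rw [sub_self] at t3
      refine t3.congr' ?_
      filter_upwards [self_mem_nhdsWithin] with y hy
      have hy' : 0 < y := hy
      rw [hM _ (by simpa using hy')]
      simp [sub_eq_add_neg]
end
end

section
/- Let R ≥ 2 and let J ∈ M_R, i.e. J is a whole-line Jacobi matrix with ‖J‖ ≤ R that is reflectionless on (−2,2). Then there exists a finite Borel measure σ supported in (−1/r, −r) ∪ (r, 1/r) such that the F function of J satisfies F(λ) = −σ_{−1} + (1 − σ_{−2})λ + ∫ dσ(t)/(t − λ) for all λ ∈ ℂ⁺, and moreover 1 − σ_{−2} + ∫ dσ(t)/(t² + Et + 1) > 0 for every real E with |E| > R. The measure σ is uniquely determined by J. -/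
open MeasureTheory Complex Filter Set

noncomputable section

/-- `f` is a solution of the difference equation
`a_n f(n+1) + a_{n-1} f(n-1) + b_n f(n) = z f(n)` on `ℤ`. -/
def JacobiSolution (a b : ℤ → ℝ) (z : ℂ) (f : ℤ → ℂ) : Prop :=
  ∀ n : ℤ, (a n : ℂ) * f (n + 1) + (a (n - 1) : ℂ) * f (n - 1) + (b n : ℂ) * f n = z * f n

/-- `f : ℤ → ℂ` is square summable near `+∞`. -/
def SquareSummableAtTop (f : ℤ → ℂ) : Prop := Summable fun n : ℕ => ‖f (n : ℤ)‖ ^ 2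

/-- `f : ℤ → ℂ` is square summable near `-∞`. -/
def SquareSummableAtBot (f : ℤ → ℂ) : Prop := Summable fun n : ℕ => ‖f (-(n : ℤ))‖ ^ 2

/-- `m` is the half-line `m`-function `m₊` of the whole-line Jacobi matrix with
coefficients `a, b`: `m₊(z) = -f₊(1,z)/(a₀ f₊(0,z))`, where `f₊(·,z)` is a nontrivial
solution that is square summable near `+∞`. -/
def IsJacobiMPlus (a b : ℤ → ℝ) (m : ℂ → ℂ) : Prop :=
  ∀ z : ℂ, 0 < z.im → ∃ f : ℤ → ℂ, JacobiSolution a b z f ∧ SquareSummableAtTop f ∧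
    f 0 ≠ 0 ∧ m z = -(f 1 / ((a 0 : ℂ) * f 0))

/-- `m` is the half-line `m`-function `m₋` of the whole-line Jacobi matrix with
coefficients `a, b`: `m₋(z) = f₋(1,z)/(a₀ f₋(0,z))`, where `f₋(·,z)` is a nontrivial
solution that is square summable near `-∞`. -/
def IsJacobiMMinus (a b : ℤ → ℝ) (m : ℂ → ℂ) : Prop :=
  ∀ z : ℂ, 0 < z.im → ∃ f : ℤ → ℂ, JacobiSolution a b z f ∧ SquareSummableAtBot f ∧
    f 0 ≠ 0 ∧ m z = f 1 / ((a 0 : ℂ) * f 0)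

/-- The pair `(m₊, m₋)` is reflectionless on `(-2,2)`:
`m₊(x) = -conj(m₋(x))` for Lebesgue-a.e. `x ∈ (-2,2)` (boundary values). -/
def ReflectionlessOn22 (mp mm : ℂ → ℂ) : Prop :=
  ∀ᵐ x : ℝ, x ∈ Set.Ioo (-2:ℝ) 2 →
    Tendsto (fun y : ℝ => mp (↑x + ↑y * I) + starRingEnd ℂ (mm (↑x + ↑y * I)))
      (nhdsWithin 0 (Set.Ioi 0)) (nhds 0)

/-- The whole-line Jacobi matrix with coefficients `a, b` is reflectionless on `(-2,2)`. -/
def JacobiReflectionless (a b : ℤ → ℝ) : Prop :=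
  ∃ mp mm : ℂ → ℂ, IsJacobiMPlus a b mp ∧ IsJacobiMMinus a b mm ∧ ReflectionlessOn22 mp mm

/-- `T` is the bounded operator on `ℓ²(ℤ)` given by the Jacobi matrix with
coefficients `a, b`: `(Tu)_n = a_n u_{n+1} + a_{n-1} u_{n-1} + b_n u_n`. -/
def IsJacobiOperator (a b : ℤ → ℝ)
    (T : lp (fun _ : ℤ => ℂ) 2 →L[ℂ] lp (fun _ : ℤ => ℂ) 2) : Prop :=
  ∀ u : lp (fun _ : ℤ => ℂ) 2, ∀ n : ℤ,
    T u n = (a n : ℂ) * u (n + 1) + (a (n - 1) : ℂ) * u (n - 1) + (b n : ℂ) * u n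

/-- `J ∈ M_R`: the whole-line Jacobi matrix with coefficients `a, b` (with `a_n > 0`)
defines a bounded operator of norm `≤ R` and is reflectionless on `(-2,2)`. -/
def MemMR (R : ℝ) (a b : ℤ → ℝ) : Prop :=
  (∀ n : ℤ, 0 < a n) ∧
  (∃ T : lp (fun _ : ℤ => ℂ) 2 →L[ℂ] lp (fun _ : ℤ => ℂ) 2,
    IsJacobiOperator a b T ∧ ‖T‖ ≤ R) ∧
  JacobiReflectionless a b

/-- The domain `Ω = ℂ⁺ ∪ (-2,2) ∪ ℂ⁻`. -/
def Omega22 : Set ℂ := {z : ℂ | z.im ≠ 0 ∨ (-2 < z.re ∧ z.re < 2)}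

/-- `F` is the `F` function of the Jacobi matrix with coefficients `a, b`, reflectionless on
`(-2,2)`: `F(λ) = M(-λ - 1/λ)` on `ℂ⁺`, where `M : Ω → ℂ⁺` is the holomorphic continuation
of `m₊` to `Ω = ℂ⁺ ∪ (-2,2) ∪ ℂ⁻`. -/
def IsFFunction (a b : ℤ → ℝ) (F : ℂ → ℂ) : Prop :=
  ∃ mp M : ℂ → ℂ, IsJacobiMPlus a b mp ∧
    DifferentiableOn ℂ M Omega22 ∧
    (∀ z ∈ Omega22, 0 < (M z).im) ∧
    (∀ z : ℂ, 0 < z.im → M z = mp z) ∧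
    (∀ l : ℂ, 0 < l.im → F l = M (-l - 1/l))



open Topology in
lemma square_side (δ : ℝ) (H : ℂ → ℂ) (γ : ℝ → ℂ) (hγ : Continuous γ)
    (hδ : 0 < δ) (hn : ∀ x, δ ≤ ‖γ x‖) (S : Set ℂ) (hH : ContinuousOn H S)
    (hS : ∀ x ∈ Icc (-δ) δ, γ x ∈ S) (p : ℝ → ℝ) (hp : ContinuousOn p (Icc (-δ) δ))
    (hb : ∀ x ∈ Icc (-δ) δ, ‖H (γ x)‖ ≤ p x) :
    ∃ e : ℂ, ‖e‖ ≤ δ⁻¹ * ∫ x in (-δ)..δ, p x ∧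
      (∫ x in (-δ)..δ, dslope H 0 (γ x)) = e - H 0 * ∫ x in (-δ)..δ, (γ x)⁻¹ := by
  have h0 : ∀ x, γ x ≠ 0 := fun x h => by
    have := hn x
    rw [h, norm_zero] at this; linarith
  have huI : uIcc (-δ) δ = Icc (-δ) δ := uIcc_of_le (by linarith)
  have hinv : Continuous fun x => (γ x)⁻¹ := hγ.inv₀ h0
  have hHc : ContinuousOn (fun x => H (γ x)) (Icc (-δ) δ) := hH.comp hγ.continuousOn hS
  have i1 : IntervalIntegrable (fun x => (γ x)⁻¹ * H (γ x)) volume (-δ) δ := by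
    apply ContinuousOn.intervalIntegrable
    rw [huI]
    exact hinv.continuousOn.mul hHc
  have i2 : IntervalIntegrable (fun x => H 0 * (γ x)⁻¹) volume (-δ) δ :=
    (continuous_const.mul hinv).intervalIntegrable _ _
  have ip : IntervalIntegrable p volume (-δ) δ := by
    apply ContinuousOn.intervalIntegrable
    rwa [huI]
  refine ⟨∫ x in (-δ)..δ, (γ x)⁻¹ * H (γ x), ?_, ?_⟩
  · rw [← intervalIntegral.integral_const_mul]
    apply intervalIntegral.norm_integral_le_of_norm_le (by linarith)
    · apply Eventually.of_forall
      intro x hx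
      have hx' := Ioc_subset_Icc_self hx
      rw [norm_mul, norm_inv]
      exact mul_le_mul (inv_anti₀ hδ (hn x)) (hb x hx') (norm_nonneg _) (by positivity)
    · exact ip.const_mul _
  · rw [← intervalIntegral.integral_const_mul, ← intervalIntegral.integral_sub i1 i2]
    congr 1
    ext x
    rw [dslope_of_ne _ (h0 x), slope_def_field]
    simp only [sub_zero]
    field_simp

lemma square_kappa (δ : ℝ) (hδ : 0 < δ) :
    (∫ x : ℝ in (-δ)..δ, ((x:ℂ) + ((-δ:ℝ):ℂ) * I)⁻¹) - (∫ x : ℝ in (-δ)..δ, ((x:ℂ) + (δ:ℂ) * I)⁻¹) +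
      I * (∫ y : ℝ in (-δ)..δ, ((δ:ℂ) + y * I)⁻¹) -
      I * (∫ y : ℝ in (-δ)..δ, (((-δ:ℝ):ℂ) + y * I)⁻¹) =
      ((4 * δ * ∫ x in (-δ)..δ, (x^2+δ^2)⁻¹ : ℝ) : ℂ) * I := by
  have n1 : ∀ x : ℝ, ((x:ℂ) + ((-δ:ℝ):ℂ) * I) ≠ 0 := fun x h => by
    have := congrArg Complex.im h; simp at this; linarith
  have n2 : ∀ x : ℝ, ((x:ℂ) + (δ:ℂ) * I) ≠ 0 := fun x h => by
    have := congrArg Complex.im h; simp at this; linarith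
  have n3 : ∀ x : ℝ, ((δ:ℂ) + x * I) ≠ 0 := fun x h => by
    have := congrArg Complex.re h; simp at this; linarith
  have n4 : ∀ x : ℝ, (((-δ:ℝ):ℂ) + x * I) ≠ 0 := fun x h => by
    have := congrArg Complex.re h; simp at this; linarith
  have n5 : ∀ x : ℝ, (x:ℂ)^2 + (δ:ℂ)^2 ≠ 0 := fun x => by
    have : (0:ℝ) < x^2+δ^2 := by positivity
    exact_mod_cast this.ne'
  rw [← intervalIntegral.integral_sub, add_sub_assoc, ← mul_sub, ← intervalIntegral.integral_sub]
  rotate_left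
  · exact (Continuous.inv₀ (by fun_prop) n3).intervalIntegrable _ _
  · exact (Continuous.inv₀ (by fun_prop) n4).intervalIntegrable _ _
  · exact (Continuous.inv₀ (by fun_prop) n1).intervalIntegrable _ _
  · exact (Continuous.inv₀ (by fun_prop) n2).intervalIntegrable _ _
  have e1 : ∀ x : ℝ, ((x:ℂ) + ((-δ:ℝ):ℂ) * I)⁻¹ - ((x:ℂ) + (δ:ℂ) * I)⁻¹
      = (2 * δ * I) * (((x^2+δ^2)⁻¹ : ℝ) : ℂ) := by
    intro x
    have q1 := n1 x; have q2 := n2 x; have q3 := n5 x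
    rw [inv_sub_inv q1 q2, ofReal_inv, ← div_eq_mul_inv]
    push_cast at *
    rw [div_eq_div_iff (mul_ne_zero q1 q2) q3]
    linear_combination (2 * δ ^ 3 * I) * I_sq
  have e2 : ∀ x : ℝ, ((δ:ℂ) + x * I)⁻¹ - (((-δ:ℝ):ℂ) + x * I)⁻¹
      = (2 * δ) * (((x^2+δ^2)⁻¹ : ℝ) : ℂ) := by
    intro x
    have q1 := n3 x; have q2 := n4 x; have q3 := n5 x
    rw [inv_sub_inv q1 q2, ofReal_inv, ← div_eq_mul_inv]
    push_cast at *
    rw [div_eq_div_iff (mul_ne_zero q1 q2) q3]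
    linear_combination (-2 * δ * x ^ 2) * I_sq
  simp_rw [e1, e2]
  rw [intervalIntegral.integral_const_mul, intervalIntegral.integral_const_mul,
    intervalIntegral.integral_ofReal]
  push_cast
  ring

lemma square_est (δ : ℝ) (hδ : 0 < δ) (H : ℂ → ℂ)
    (hH : DifferentiableOn ℂ H (Icc (-δ) δ ×ℂ Icc (-δ) δ))
    (p : ℝ → ℝ) (hp : ContinuousOn p (Icc (-δ) δ))
    (h1 : ∀ x ∈ Icc (-δ) δ, ‖H (x + δ * I)‖ ≤ p x)
    (h2 : ∀ x ∈ Icc (-δ) δ, ‖H (x + (-δ : ℝ) * I)‖ ≤ p (-x))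
    (h3 : ∀ x ∈ Icc (-δ) δ, ‖H (δ + x * I)‖ ≤ p (-x))
    (h4 : ∀ x ∈ Icc (-δ) δ, ‖H ((-δ : ℝ) + x * I)‖ ≤ p x) :
    (4 * δ * ∫ x in (-δ)..δ, (x^2+δ^2)⁻¹) * ‖H 0‖ ≤ 4 * (δ⁻¹ * ∫ x in (-δ)..δ, p x) := by
  have hm : (Icc (-δ) δ ×ℂ Icc (-δ) δ) ∈ nhds (0:ℂ) := by
    apply Filter.mem_of_superset (Metric.ball_mem_nhds (0:ℂ) hδ)
    intro z hz
    rw [mem_ball_zero_iff] at hz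
    rw [Complex.mem_reProdIm]
    exact ⟨abs_le.mp ((abs_re_le_norm z).trans hz.le), abs_le.mp ((abs_im_le_norm z).trans hz.le)⟩
  have hd := (Complex.differentiableOn_dslope hm).mpr hH
  have hp' : ContinuousOn (fun x => p (-x)) (Icc (-δ) δ) := by
    apply hp.comp continuousOn_neg
    intro x hx
    constructor <;> linarith [hx.1, hx.2]
  have hpi : ∫ x in (-δ)..δ, p (-x) = ∫ x in (-δ)..δ, p x := by
    rw [intervalIntegral.integral_comp_neg, neg_neg]
  have key := Complex.integral_boundary_rect_eq_zero_of_differentiableOn (dslope H 0)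
    ((-δ:ℝ) + (-δ:ℝ) * I) ((δ:ℝ) + (δ:ℝ) * I) (by
      simp only [add_re, mul_re, ofReal_re, I_re, ofReal_im, I_im, add_im, mul_im]
      ring_nf
      rw [uIcc_of_le (by linarith)]
      exact hd)
  have r1 : ((((-δ:ℝ):ℂ) + ((-δ:ℝ):ℂ) * I)).re = -δ := by simp
  have r2 : ((((-δ:ℝ):ℂ) + ((-δ:ℝ):ℂ) * I)).im = -δ := by simp
  have r3 : ((((δ:ℝ):ℂ) + ((δ:ℝ):ℂ) * I)).re = δ := by simp
  have r4 : ((((δ:ℝ):ℂ) + ((δ:ℝ):ℂ) * I)).im = δ := by simp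
  rw [r1, r2, r3, r4] at key
  have nr : ∀ z : ℂ, |z.re| = δ → δ ≤ ‖z‖ := fun z h => h ▸ abs_re_le_norm z
  have ni : ∀ z : ℂ, |z.im| = δ → δ ≤ ‖z‖ := fun z h => h ▸ abs_im_le_norm z
  have hδm : δ ∈ Icc (-δ) δ := ⟨by linarith, le_rfl⟩
  have hδm' : -δ ∈ Icc (-δ) δ := ⟨le_rfl, by linarith⟩
  obtain ⟨e1, he1, E1⟩ := square_side δ H (fun x => x + (δ:ℂ) * I) (by fun_prop) hδ
    (fun x => ni _ (by simp [abs_of_pos hδ])) _ hH.continuousOn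
    (fun x hx => by rw [Complex.mem_reProdIm]; simp; exact ⟨hx, by linarith⟩) p hp h1
  obtain ⟨e2, he2, E2⟩ := square_side δ H (fun x => x + ((-δ:ℝ):ℂ) * I) (by fun_prop) hδ
    (fun x => ni _ (by simp [abs_of_pos hδ])) _ hH.continuousOn
    (fun x hx => by rw [Complex.mem_reProdIm]; simp; exact ⟨hx, by linarith⟩) _ hp' h2
  obtain ⟨e3, he3, E3⟩ := square_side δ H (fun x => (δ:ℂ) + x * I) (by fun_prop) hδ
    (fun x => nr _ (by simp [abs_of_pos hδ])) _ hH.continuousOn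
    (fun x hx => by rw [Complex.mem_reProdIm]; simp; exact ⟨by linarith, hx⟩) _ hp' h3
  obtain ⟨e4, he4, E4⟩ := square_side δ H (fun x => ((-δ:ℝ):ℂ) + x * I) (by fun_prop) hδ
    (fun x => nr _ (by simp [abs_of_pos hδ])) _ hH.continuousOn
    (fun x hx => by rw [Complex.mem_reProdIm]; simp; exact ⟨by linarith, hx⟩) _ hp h4
  rw [hpi] at he2 he3
  rw [E1, E2, E3, E4] at key
  have hk := square_kappa δ hδ
  have hpos : 0 ≤ ∫ x in (-δ)..δ, (x^2+δ^2)⁻¹ :=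
    intervalIntegral.integral_nonneg (by linarith) (fun x _ => by positivity)
  have hfin : H 0 * (((4 * δ * ∫ x in (-δ)..δ, (x^2+δ^2)⁻¹ : ℝ) : ℂ) * I)
      = e2 - e1 + I * e3 - I * e4 := by
    rw [← hk]
    simp only [smul_eq_mul] at key
    linear_combination -key
  have hnorm := congrArg norm hfin
  rw [norm_mul, norm_mul, norm_I, mul_one, Complex.norm_real, Real.norm_eq_abs,
    abs_of_nonneg (by positivity)] at hnorm
  have : ‖e2 - e1 + I * e3 - I * e4‖ ≤ ‖e2‖ + ‖e1‖ + ‖e3‖ + ‖e4‖ := by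
    refine (norm_sub_le _ _).trans ?_
    rw [norm_mul, norm_I, one_mul]
    gcongr
    refine (norm_add_le _ _).trans ?_
    rw [norm_mul, norm_I, one_mul]
    gcongr
    exact norm_sub_le _ _
  rw [mul_comm] at hnorm
  linarith

/-- Boundary uniqueness. -/
lemma bdry_unique (g : ℂ → ℂ) (hg : DifferentiableOn ℂ g {z | z.im < 0}) (C : ℝ)
    (hC : ∀ z : ℂ, z.im < 0 → ‖g z‖ ≤ C)
    (hlim : ∀ᵐ x : ℝ, x ∈ Ioo (-2:ℝ) 2 →
      Tendsto (fun y : ℝ => g (x - y * I)) (nhdsWithin 0 (Ioi 0)) (nhds 0)) :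
    ∀ z : ℂ, z.im < 0 → g z = 0 := by
  have hopen : IsOpen {z : ℂ | z.im < 0} := isOpen_lt continuous_im continuous_const
  have hC0 : 0 ≤ C := (norm_nonneg _).trans (hC (-I) (by simp))
  have hloc : ∀ x0 δ : ℝ, 0 < δ → -2 < x0 - δ → x0 + δ < 2 → g (x0 - δ * I) = 0 := by
    intro x0 δ hδ hl hu
    have hlim' : ∀ᵐ x : ℝ, x ∈ Ioc (-δ) δ →
      Tendsto (fun y : ℝ => ‖g (x0 + x - y * I)‖) (nhdsWithin 0 (Ioi 0)) (nhds 0) := by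
      have := (measurePreserving_add_left volume x0).quasiMeasurePreserving.ae hlim
      filter_upwards [this] with x hx hx2
      have := (hx ⟨by linarith [hx2.1], by linarith [hx2.2]⟩).norm
      simpa using this
    have hdct : Tendsto (fun y : ℝ => ∫ x in (-δ)..δ, ‖g (x0 + x - y * I)‖)
        (nhdsWithin 0 (Ioi 0)) (nhds (∫ x in (-δ)..δ, (0:ℝ))) := by
      apply intervalIntegral.tendsto_integral_filter_of_dominated_convergence (fun _ => C)
      · filter_upwards [self_mem_nhdsWithin] with y hy
        have : Continuous fun x : ℝ => ‖g (x0 + x - y * I)‖ := by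
          apply Continuous.norm
          apply hg.continuousOn.comp_continuous (by fun_prop)
          intro x
          simpa using hy
        exact this.aestronglyMeasurable
      · filter_upwards [self_mem_nhdsWithin] with y hy
        apply Eventually.of_forall
        intro x _
        rw [norm_norm]
        exact hC _ (by simpa using hy)
      · exact intervalIntegrable_const
      · have : uIoc (-δ) δ = Ioc (-δ) δ := uIoc_of_le (by linarith)
        rw [this]
        exact hlim'
    set κ := 4 * δ * ∫ x in (-δ)..δ, (x^2+δ^2)⁻¹ with hκ
    have hκpos : 0 < κ := by
      apply mul_pos (by linarith)
      apply intervalIntegral.intervalIntegral_pos_of_pos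
      · apply Continuous.intervalIntegrable
        apply Continuous.inv₀ (by fun_prop)
        intro x; positivity
      · intro x; positivity
      · linarith
    have hest : ∀ y : ℝ, 0 < y → κ * ‖g (x0 - (δ + y) * I)‖ ^ 4 ≤
        4 * (δ⁻¹ * ∫ x in (-δ)..δ, C^3 * ‖g (x0 + x - y * I)‖) := by
      intro y hy
      set c : ℂ := x0 - (δ + y) * I with hc
      have him : ∀ w : ℂ, w.im ≤ δ → (c + w).im < 0 := by
        intro w hw; simp [hc]; linarith
      have hreg : ∀ w ∈ Icc (-δ) δ ×ℂ Icc (-δ) δ, (c + w).im < 0 ∧ (c - w).im < 0 ∧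
          (c + I * w).im < 0 ∧ (c - I * w).im < 0 := by
        intro w hw
        rw [Complex.mem_reProdIm] at hw
        obtain ⟨⟨a1, a2⟩, a3, a4⟩ := hw
        simp [hc]
        refine ⟨?_, ?_, ?_, ?_⟩ <;> linarith
      have hsq := square_est δ hδ (fun w => g (c + w) * g (c - w) * g (c + I * w) * g (c - I * w))
        (by
          have d1 : ∀ u : ℂ → ℂ, Differentiable ℂ u →
              (∀ w ∈ Icc (-δ) δ ×ℂ Icc (-δ) δ, (u w).im < 0) →
              DifferentiableOn ℂ (fun w => g (u w)) (Icc (-δ) δ ×ℂ Icc (-δ) δ) :=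
            fun u hu h => hg.comp hu.differentiableOn h
          exact (((d1 _ (by fun_prop) (fun w hw => (hreg w hw).1)).mul
            (d1 _ (by fun_prop) (fun w hw => (hreg w hw).2.1))).mul
            (d1 _ (by fun_prop) (fun w hw => (hreg w hw).2.2.1))).mul
            (d1 _ (by fun_prop) (fun w hw => (hreg w hw).2.2.2)))
        (fun x => C^3 * ‖g (x0 + x - y * I)‖)
        (by
          apply Continuous.continuousOn
          apply continuous_const.mul
          apply Continuous.norm
          apply hg.continuousOn.comp_continuous (by fun_prop)
          intro x
          simpa using hy)
        (by
          intro x hx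
          obtain ⟨q1, q2, q3, q4⟩ := hreg (x + δ * I) (by
            rw [Complex.mem_reProdIm]; simp; exact ⟨hx, by linarith⟩)
          have e : c + (x + δ * I) = x0 + x - y * I := by rw [hc]; ring
          rw [← e]
          simp only [norm_mul]
          have := hC _ q1; have := hC _ q2; have := hC _ q3; have := hC _ q4
          calc _ ≤ ‖g (c + (x + δ * I))‖ * C * C * C := by gcongr
            _ = _ := by ring)
        (by
          intro x hx
          obtain ⟨q1, q2, q3, q4⟩ := hreg (x + (-δ:ℝ) * I) (by
            rw [Complex.mem_reProdIm]; simp; exact ⟨hx, by linarith⟩)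
          have e : c - (x + (-δ:ℝ) * I) = x0 + (-x:ℝ) - y * I := by rw [hc]; push_cast; ring
          rw [← e]
          simp only [norm_mul]
          have := hC _ q1; have := hC _ q2; have := hC _ q3; have := hC _ q4
          calc _ ≤ C * ‖g (c - (x + (-δ:ℝ) * I))‖ * C * C := by gcongr
            _ = _ := by ring)
        (by
          intro x hx
          obtain ⟨q1, q2, q3, q4⟩ := hreg (δ + x * I) (by
            rw [Complex.mem_reProdIm]; simp; exact ⟨by linarith, hx⟩)
          have e : c + I * (δ + x * I) = x0 + (-x:ℝ) - y * I := by
            rw [hc]; push_cast; linear_combination (x:ℂ) * I_mul_I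
          rw [← e]
          simp only [norm_mul]
          have := hC _ q1; have := hC _ q2; have := hC _ q3; have := hC _ q4
          calc _ ≤ C * C * ‖g (c + I * (δ + x * I))‖ * C := by gcongr
            _ = _ := by ring)
        (by
          intro x hx
          obtain ⟨q1, q2, q3, q4⟩ := hreg ((-δ:ℝ) + x * I) (by
            rw [Complex.mem_reProdIm]; simp; exact ⟨by linarith, hx⟩)
          have e : c - I * ((-δ:ℝ) + x * I) = x0 + x - y * I := by
            rw [hc]; push_cast; linear_combination -(x:ℂ) * I_mul_I
          rw [← e]
          simp only [norm_mul]
          have := hC _ q1; have := hC _ q2; have := hC _ q3; have := hC _ q4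
          calc _ ≤ C * C * C * ‖g (c - I * ((-δ:ℝ) + x * I))‖ := by gcongr
            _ = _ := by ring)
      refine le_trans (le_of_eq ?_) hsq
      simp
      ring
    have hL : Tendsto (fun y : ℝ => κ * ‖g (x0 - (δ + y) * I)‖ ^ 4) (nhdsWithin 0 (Ioi 0))
        (nhds (κ * ‖g (x0 - (δ + (0:ℝ)) * I)‖ ^ 4)) := by
      apply Tendsto.mono_left _ nhdsWithin_le_nhds
      have : ContinuousAt g (x0 - (δ + (0:ℝ)) * I) :=
        (hg.differentiableAt (hopen.mem_nhds (by simpa using hδ))).continuousAt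
      have h2 : ContinuousAt (fun y : ℝ => g (x0 - (δ + y) * I)) 0 :=
        ContinuousAt.comp (f := fun y : ℝ => (x0 - (δ + y) * I : ℂ)) this (by fun_prop)
      exact (continuousAt_const.mul (h2.norm.pow 4)).tendsto
    have hR : Tendsto (fun y : ℝ => 4 * (δ⁻¹ * ∫ x in (-δ)..δ, C^3 * ‖g (x0 + x - y * I)‖))
        (nhdsWithin 0 (Ioi 0)) (nhds 0) := by
      simp_rw [intervalIntegral.integral_const_mul]
      have := ((hdct.const_mul (C^3)).const_mul δ⁻¹).const_mul 4
      simpa using this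
    have hle := le_of_tendsto_of_tendsto hL hR (by
      filter_upwards [self_mem_nhdsWithin] with y hy using hest y hy)
    have h4 : ‖g (x0 - (δ + (0:ℝ)) * I)‖ ^ 4 ≤ 0 := by
      by_contra hcon
      push Not at hcon
      have := mul_pos hκpos hcon
      linarith
    have h5 : ‖g (x0 - (δ + (0:ℝ)) * I)‖ = 0 := by
      have := pow_nonneg (norm_nonneg (g (x0 - (δ + (0:ℝ)) * I))) 4
      exact pow_eq_zero_iff (n := 4) (by norm_num) |>.mp (le_antisymm h4 this)
    simpa using h5
  have han : AnalyticOnNhd ℂ g {z | z.im < 0} := hg.analyticOnNhd hopen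
  have := han.eqOn_zero_of_preconnected_of_eventuallyEq_zero
    (convex_halfSpace_im_lt 0).isPreconnected (z₀ := -((1/2:ℝ):ℂ) * I) (by simp) (by
      filter_upwards [Metric.ball_mem_nhds _ (show (0:ℝ) < 1/4 by norm_num)] with z hz
      rw [Metric.mem_ball, dist_eq_norm] at hz
      have h1 := (abs_re_le_norm _).trans_lt hz
      have h2 := (abs_im_le_norm _).trans_lt hz
      rw [abs_lt] at h1 h2
      simp at h1 h2
      have := hloc z.re (-z.im) (by linarith) (by linarith) (by linarith)
      have e : (z.re - (-z.im : ℝ) * I : ℂ) = z := by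
        apply Complex.ext <;> simp
      rw [e] at this
      exact this)
  exact fun z hz => this hz


lemma disc_poisson (f : ℂ → ℂ) (hf : DifferentiableOn ℂ f (Metric.ball 0 1)) (s : ℝ) (hs0 : 0 < s)
    (hs1 : s < 1) (w : ℂ) (hw : w ∈ Metric.ball (0:ℂ) 1) :
    (f (s * w)).im = (2 * Real.pi)⁻¹ * ∫ θ in (0:ℝ)..(2 * Real.pi),
      poissonKernel 0 w (circleMap 0 1 θ) * (f (s * circleMap 0 1 θ)).im := by
  have hd : DiffContOnCl ℂ (fun z => f (s * z)) (Metric.ball 0 1) := by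
    apply DifferentiableOn.diffContOnCl
    rw [closure_ball _ (by norm_num)]
    apply hf.comp (by fun_prop)
    intro z hz
    simp at hz ⊢
    rw [abs_of_pos hs0]
    nlinarith [norm_nonneg z]
  have h := hd.circleAverage_poissonKernel_smul hw
  rw [Real.circleAverage_def] at h
  have h2 := congrArg Complex.im h
  rw [← h2, Complex.smul_im, smul_eq_mul]
  congr 1
  have hIntg : IntervalIntegrable (fun θ => (poissonKernel 0 w • fun z => f (s * z)) (circleMap 0 1 θ))
      volume 0 (2 * Real.pi) := by
    apply Continuous.intervalIntegrable
    have c1 : Continuous fun θ => f (s * circleMap 0 1 θ) := by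
      apply hf.continuousOn.comp_continuous (by fun_prop)
      intro x
      simp [abs_of_pos hs0, hs1]
    have c2 : Continuous fun θ => poissonKernel 0 w (circleMap 0 1 θ) := by
      simp only [poissonKernel_def]
      apply Continuous.div (by fun_prop) (by fun_prop)
      intro x
      have : circleMap 0 1 x - w ≠ 0 := by
        rw [sub_ne_zero]
        exact circleMap_ne_mem_ball hw x
      simpa using this
    exact c2.smul c1
  have h3 := Complex.imCLM.intervalIntegral_comp_comm hIntg
  simp only [imCLM_apply] at h3
  rw [← h3]
  congr 1
  ext θ
  simp

lemma disc_herglotz (f : ℂ → ℂ) (hf : DifferentiableOn ℂ f (Metric.ball 0 1))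
    (hpos : ∀ z ∈ Metric.ball (0:ℂ) 1, 0 ≤ (f z).im) :
    ∃ μ : Measure (Icc (0:ℝ) (2 * Real.pi)), IsFiniteMeasure μ ∧
      ∀ w ∈ Metric.ball (0:ℂ) 1, (f w).im = ∫ θ, poissonKernel 0 w (circleMap 0 1 θ) ∂μ := by
  set E := Icc (0:ℝ) (2 * Real.pi) with hE
  have hpi : (0:ℝ) ≤ 2 * Real.pi := by positivity
  let s : ℕ → ℝ := fun n => 1 - 1 / ((n:ℝ) + 2)
  have hs0 : ∀ n, 0 < s n := fun n => by
    have : (1:ℝ) / ((n:ℝ) + 2) < 1 := by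
      rw [div_lt_one (by positivity)]
      have : (0:ℝ) ≤ n := by positivity
      linarith
    simp only [s]; linarith
  have hs1 : ∀ n, s n < 1 := fun n => by
    have : (0:ℝ) < 1 / ((n:ℝ) + 2) := by positivity
    simp only [s]; linarith
  have hslim : Tendsto s atTop (nhds 1) := by
    have h1 : Tendsto (fun n : ℕ => 1 / ((n:ℝ) + 2)) atTop (nhds 0) := by
      have := tendsto_atTop_add_const_right atTop (2:ℝ) tendsto_natCast_atTop_atTop
      exact this.inv_tendsto_atTop.congr (fun n => by simp)
    have h2 := h1.const_sub 1
    rw [sub_zero] at h2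
    exact h2
  let d : ℕ → ℝ → ℝ := fun n θ => (2 * Real.pi)⁻¹ * (f (s n * circleMap 0 1 θ)).im
  have hdc : ∀ n, Continuous (d n) := fun n => by
    apply continuous_const.mul
    apply continuous_im.comp
    apply hf.continuousOn.comp_continuous (by fun_prop)
    intro x
    simp [abs_of_pos (hs0 n), hs1 n]
  have hd0 : ∀ n θ, 0 ≤ d n θ := fun n θ => by
    apply mul_nonneg (by positivity)
    apply hpos
    simp [abs_of_pos (hs0 n), hs1 n]
  let μ : ℕ → Measure E := fun n =>
    (Measure.comap Subtype.val volume : Measure E).withDensity (fun x => ENNReal.ofReal (d n x))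
  have hIntg : ∀ n (g : ℝ → ℝ), ∫ x : E, g x ∂(μ n) = ∫ θ in (0:ℝ)..(2 * Real.pi), d n θ * g θ := by
    intro n g
    simp only [μ]
    rw [integral_withDensity_eq_integral_toReal_smul]
    · have : ∀ x : E, (ENNReal.ofReal (d n x)).toReal • g x = (fun θ => d n θ * g θ) x := by
        intro x
        rw [ENNReal.toReal_ofReal (hd0 n x), smul_eq_mul]
      simp_rw [this]
      rw [integral_subtype_comap (s := E) measurableSet_Icc (fun θ => d n θ * g θ), integral_Icc_eq_integral_Ioc,
        intervalIntegral.integral_of_le hpi]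
    · exact ENNReal.measurable_ofReal.comp ((hdc n).measurable.comp measurable_subtype_coe)
    · exact Eventually.of_forall (fun x => ENNReal.ofReal_lt_top)
  have hfin : ∀ n, IsFiniteMeasure (μ n) := fun n => by
    apply isFiniteMeasure_withDensity_ofReal
    apply Integrable.hasFiniteIntegral
    have : IsFiniteMeasure (Measure.comap Subtype.val volume : Measure E) := by
      constructor
      rw [(MeasurableEmbedding.subtype_coe (measurableSet_Icc)).comap_apply]
      refine lt_of_le_of_lt (measure_mono (t := E) ?_) ?_
      · rintro _ ⟨x, -, rfl⟩
        exact x.2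
      · rw [hE, Real.volume_Icc]
        exact ENNReal.ofReal_lt_top
    have : Integrable (fun x : E => d n x) (Measure.comap Subtype.val volume) := by
      apply Continuous.integrable_of_hasCompactSupport
      · exact (hdc n).comp continuous_subtype_val
      · exact HasCompactSupport.of_compactSpace _
    exact this
  have hpoi : ∀ n, ∀ w ∈ Metric.ball (0:ℂ) 1,
      ∫ x : E, poissonKernel 0 w (circleMap 0 1 x) ∂(μ n) = (f (s n * w)).im := by
    intro n w hw
    rw [hIntg n (fun x => poissonKernel 0 w (circleMap 0 1 x)), disc_poisson f hf _ (hs0 n) (hs1 n) w hw,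
      ← intervalIntegral.integral_const_mul]
    congr 1
    ext θ
    simp only [d]; ring
  have hmass : ∀ n, (μ n).real univ = (f 0).im := by
    intro n
    have := hpoi n 0 (by simp)
    rw [mul_zero] at this
    rw [← this]
    simp [poissonKernel_def]
  let ν : ℕ → FiniteMeasure E := fun n => ⟨μ n, hfin n⟩
  have hcpt := isCompact_setOfPred_finiteMeasure_le_of_compactSpace E (f 0).im.toNNReal
  have hmem : ∀ n, ν n ∈ {μ : FiniteMeasure E | μ.mass ≤ (f 0).im.toNNReal} := by
    intro n
    have h := hmass n
    show (ν n).mass ≤ _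
    rw [← NNReal.coe_le_coe, Real.coe_toNNReal _ (hpos 0 (by simp)), ← h]
    exact le_of_eq rfl
  obtain ⟨μ0, -, hμ0⟩ := hcpt.ultrafilter_le_nhds (Ultrafilter.map ν (hyperfilter ℕ)) (by
    simp only [le_principal_iff]
    exact Filter.Eventually.of_forall (f := (hyperfilter ℕ : Filter ℕ)) hmem)
  have hT : Tendsto ν (hyperfilter ℕ : Filter ℕ) (nhds μ0) := hμ0
  rw [FiniteMeasure.tendsto_iff_forall_integral_tendsto] at hT
  refine ⟨μ0, inferInstance, fun w hw => ?_⟩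
  have c2 : Continuous fun θ : E => poissonKernel 0 w (circleMap 0 1 θ) := by
    simp only [poissonKernel_def]
    apply Continuous.div (by fun_prop) (by fun_prop)
    intro x
    have : circleMap 0 1 x - w ≠ 0 := by
      rw [sub_ne_zero]
      exact circleMap_ne_mem_ball hw x
    simpa using this
  have h1 := hT (BoundedContinuousFunction.mkOfCompact ⟨_, c2⟩)
  have h2 : Tendsto (fun n => (f (s n * w)).im) (hyperfilter ℕ : Filter ℕ) (nhds (f w).im) := by
    apply Tendsto.mono_left _ (Nat.hyperfilter_le_atTop)
    apply (continuous_im.tendsto _).comp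
    have hc : ContinuousAt f w := (hf.differentiableAt (Metric.isOpen_ball.mem_nhds hw)).continuousAt
    apply hc.tendsto.comp
    have h3 : Tendsto (fun n => (s n : ℂ)) atTop (nhds ((1:ℝ):ℂ)) :=
      (Complex.continuous_ofReal.tendsto 1).comp hslim
    simpa using h3.mul_const w
  refine tendsto_nhds_unique h2 (h1.congr ?_)
  intro n
  exact hpoi n w hw



lemma cayley_im (w : ℂ) (hw : ‖w‖ < 1) : 0 < (I * (1 + w) / (1 - w)).im := by
  have h1 : (1 - w) ≠ 0 := by
    rw [sub_ne_zero]; rintro rfl; simp at hw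
  have h2 : normSq w < 1 := by
    rw [normSq_eq_norm_sq]; nlinarith [norm_nonneg w]
  have h3 : 0 < normSq (1 - w) := normSq_pos.mpr h1
  rw [div_im]
  rw [← sub_div]
  apply div_pos _ h3
  rw [normSq_apply] at h2
  simp
  nlinarith

lemma kernel_one (l w : ℂ) (hl : 0 < l.im) (hw : w = (l - I) / (l + I)) :
    poissonKernel 0 w 1 = l.im := by
  have h1 : l + I ≠ 0 := by
    intro h; have := congrArg Complex.im h; simp at this; linarith
  have h2 : 0 < normSq (l + I) := normSq_pos.mpr h1
  rw [poissonKernel_def]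
  have e : (1:ℂ) - 0 - (w - 0) = 2 * I / (l + I) := by
    rw [hw]; field_simp; ring
  rw [e, hw]
  simp only [sub_zero, ← normSq_eq_norm_sq, normSq_div]
  have h3 : normSq (2 * I) = 4 := by simp [normSq_apply]; norm_num
  rw [h3]
  have h4 : normSq (1:ℂ) = 1 := by simp
  rw [h4]
  have h5 : normSq (l + I) - normSq (l - I) = 4 * l.im := by
    simp [normSq_apply]; ring
  field_simp
  linarith

lemma kernel_off (l w ζ : ℂ) (hl : 0 < l.im) (hw : w = (l - I) / (l + I)) (t : ℝ)
    (hζ : ζ = (t - I) / (t + I)) :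
    poissonKernel 0 w ζ = (1 + t ^ 2) * l.im / normSq (t - l) := by
  have h1 : l + I ≠ 0 := by
    intro h; have := congrArg Complex.im h; simp at this; linarith
  have h1' : (t:ℂ) + I ≠ 0 := by
    intro h; have := congrArg Complex.im h; simp at this
  have h0 : (t:ℂ) - l ≠ 0 := by
    intro h; have := congrArg Complex.im h; simp at this; linarith
  have h2 : 0 < normSq (l + I) := normSq_pos.mpr h1
  have h2' : 0 < normSq (t - l) := normSq_pos.mpr h0
  rw [poissonKernel_def]
  have e : ζ - 0 - (w - 0) = 2 * I * (t - l) / ((t + I) * (l + I)) := by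
    rw [hw, hζ]; field_simp; ring
  rw [e, hw, hζ]
  simp only [sub_zero, ← normSq_eq_norm_sq, normSq_div, normSq_mul]
  have h3 : normSq (2:ℂ) * normSq I = 4 := by simp [normSq_apply]; norm_num
  rw [h3]
  have h4 : normSq ((t:ℂ) + I) = 1 + t ^ 2 := by simp [normSq_apply]; ring
  have h4' : normSq ((t:ℂ) - I) = 1 + t ^ 2 := by simp [normSq_apply]; ring
  rw [h4, h4']
  have h5 : normSq (l + I) - normSq (l - I) = 4 * l.im := by
    simp [normSq_apply]; ring
  have h6 : (0:ℝ) < 1 + t ^ 2 := by positivity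
  field_simp
  linear_combination h5

lemma circle_cayley (ζ : ℂ) (hζ : ‖ζ‖ = 1) (h1 : ζ ≠ 1) :
    ζ = (((I * (1 + ζ) / (1 - ζ)).re : ℝ) - I) / (((I * (1 + ζ) / (1 - ζ)).re : ℝ) + I) := by
  have h2 : 1 - ζ ≠ 0 := sub_ne_zero.mpr (Ne.symm h1)
  have h3 : normSq ζ = 1 := by rw [normSq_eq_norm_sq, hζ]; norm_num
  have him : (I * (1 + ζ) / (1 - ζ)).im = 0 := by
    rw [div_im, ← sub_div]
    rw [normSq_apply] at h3
    rw [div_eq_zero_iff]; left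
    simp
    nlinarith
  have hre : (((I * (1 + ζ) / (1 - ζ)).re : ℝ) : ℂ) = I * (1 + ζ) / (1 - ζ) := by
    apply Complex.ext <;> simp [him]
  rw [hre]
  have e1 : I * (1 + ζ) / (1 - ζ) - I = 2 * I * ζ / (1 - ζ) := by field_simp; ring
  have e2 : I * (1 + ζ) / (1 - ζ) + I = 2 * I / (1 - ζ) := by field_simp; ring
  rw [e1, e2]
  field_simp

lemma halfplane_herglotz (F : ℂ → ℂ) (hF : DifferentiableOn ℂ F {z : ℂ | 0 < z.im})
    (hpos : ∀ z : ℂ, 0 < z.im → 0 ≤ (F z).im) :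
    ∃ B : ℝ, 0 ≤ B ∧ ∃ ν : Measure ℝ, IsFiniteMeasure ν ∧ ∀ l : ℂ, 0 < l.im →
      (F l).im = B * l.im + ∫ t : ℝ, (1 + t ^ 2) * l.im / normSq (t - l) ∂ν := by
  obtain ⟨μ, hμ, h⟩ := disc_herglotz (fun w => F (I * (1 + w) / (1 - w))) (by
    apply hF.comp
    · intro w hw
      apply DifferentiableAt.differentiableWithinAt
      apply DifferentiableAt.div (by fun_prop) (by fun_prop)
      rw [sub_ne_zero]; rintro rfl; simp at hw
    · intro w hw
      exact cayley_im w (by simpa using hw)) (by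
    intro w hw
    exact hpos _ (cayley_im w (by simpa using hw)))
  let c : Icc (0:ℝ) (2 * Real.pi) → ℂ := fun θ => circleMap 0 1 θ
  have hc : Continuous c := by simp only [c]; fun_prop
  let A : Set (Icc (0:ℝ) (2 * Real.pi)) := {θ | c θ = 1}
  have hA : MeasurableSet A := hc.measurable (measurableSet_singleton 1)
  let T : Icc (0:ℝ) (2 * Real.pi) → ℝ := fun θ => (I * (1 + c θ) / (1 - c θ)).re
  have hT : Measurable T := by
    apply Complex.measurable_re.comp
    have := hc.measurable
    fun_prop
  refine ⟨μ.real A, measureReal_nonneg, Measure.map T (μ.restrict Aᶜ), inferInstance, ?_⟩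
  intro l hl
  have hl1 : l + I ≠ 0 := by
    intro h; have := congrArg Complex.im h; simp at this; linarith
  set w : ℂ := (l - I) / (l + I) with hw
  have hwb : w ∈ Metric.ball (0:ℂ) 1 := by
    rw [mem_ball_zero_iff, hw, norm_div, div_lt_one (by positivity)]
    have : ‖l - I‖ ^ 2 < ‖l + I‖ ^ 2 := by
      rw [← normSq_eq_norm_sq, ← normSq_eq_norm_sq]
      simp [normSq_apply]; nlinarith
    exact lt_of_pow_lt_pow_left₀ 2 (norm_nonneg _) this
  have hlw : I * (1 + w) / (1 - w) = l := by
    have e1 : 1 + w = 2 * l / (l + I) := by rw [hw]; field_simp; ring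
    have e2 : 1 - w = 2 * I / (l + I) := by rw [hw]; field_simp; ring
    rw [e1, e2]; field_simp
  have h1 := h w hwb
  simp only [hlw] at h1
  rw [h1]
  have c2 : Continuous fun θ : Icc (0:ℝ) (2 * Real.pi) => poissonKernel 0 w (circleMap 0 1 θ) := by
    simp only [poissonKernel_def]
    apply Continuous.div (by fun_prop) (by fun_prop)
    intro x
    have : circleMap 0 1 x - w ≠ 0 := by
      rw [sub_ne_zero]
      exact circleMap_ne_mem_ball hwb x
    simpa using this
  have hi : Integrable (fun θ : Icc (0:ℝ) (2 * Real.pi) => poissonKernel 0 w (circleMap 0 1 θ)) μ :=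
    c2.integrable_of_hasCompactSupport (HasCompactSupport.of_compactSpace _)
  rw [← integral_add_compl hA hi]
  congr 1
  · rw [setIntegral_congr_fun (g := fun _ => l.im) hA]
    · simp
    · intro θ hθ
      have : circleMap 0 1 (θ:ℝ) = 1 := hθ
      show poissonKernel 0 w (circleMap 0 1 (θ:ℝ)) = l.im
      rw [this, kernel_one l w hl hw]
  · rw [integral_map hT.aemeasurable]
    · apply setIntegral_congr_fun hA.compl
      intro θ hθ
      exact kernel_off l w (circleMap 0 1 (θ:ℝ)) hl hw (T θ)
        (circle_cayley _ (by simp) hθ)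
    · apply Continuous.aestronglyMeasurable
      apply Continuous.div (by fun_prop)
      · exact continuous_normSq.comp (by fun_prop)
      · intro t
        have h0 : (t:ℂ) - l ≠ 0 := by
          intro h; have := congrArg Complex.im h; simp at this; linarith
        simpa using h0



lemma stieltjes_hasDerivAt (σ : Measure ℝ) [IsFiniteMeasure σ] (K : Set ℝ) (hK : IsClosed K)
    (hσ : σ Kᶜ = 0) (l : ℂ) (hl : ∀ t ∈ K, (t:ℂ) ≠ l) :
    HasDerivAt (fun l : ℂ => ∫ t : ℝ, ((t:ℂ) - l)⁻¹ ∂σ) (∫ t : ℝ, (((t:ℂ) - l)⁻¹) ^ 2 ∂σ) l := by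
  have hs : σ.support ⊆ K := Measure.support_subset_of_isClosed hK (mem_ae_iff.mpr hσ)
  have h := hasDerivAt_resolventTransform (μ := σ) l (by
    rintro ⟨t, ht, h⟩
    exact hl t (hs ht) h)
  simp only [resolventTransform_def, resolvent, Ring.inverse_eq_inv'] at h
  exact h

lemma stieltjes_integrable (σ : Measure ℝ) [IsFiniteMeasure σ] (K : Set ℝ) (hK : IsClosed K)
    (hσ : σ Kᶜ = 0) (l : ℂ) (hl : ∀ t ∈ K, (t:ℂ) ≠ l) :
    Integrable (fun t : ℝ => ((t:ℂ) - l)⁻¹) σ := by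
  have hs : σ.support ⊆ K := Measure.support_subset_of_isClosed hK (mem_ae_iff.mpr hσ)
  have h := integrable_resolvent (μ := σ) (a := l) (by
    rintro ⟨t, ht, h⟩
    exact hl t (hs ht) h)
  have e : (resolvent l : ℝ → ℂ) = (fun t : ℝ => ((t:ℂ) - l)⁻¹) := by
    ext t; simp [resolvent]
  rwa [e] at h

lemma kernel_integrable (ν : Measure ℝ) [IsFiniteMeasure ν] (l : ℂ) (hl : 0 < l.im) :
    Integrable (fun t : ℝ => (1 + t ^ 2) * l.im / normSq (t - l)) ν := by
  have hn : ∀ t : ℝ, normSq ((t:ℂ) - l) = (t - l.re) ^ 2 + l.im ^ 2 := fun t => by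
    simp [normSq_apply]; ring
  have hp : ∀ t : ℝ, 0 < (t - l.re) ^ 2 + l.im ^ 2 := fun t => by positivity
  refine Integrable.of_bound (C := (2 + (1 + 2 * l.re ^ 2) / l.im ^ 2) * l.im) ?_ (Eventually.of_forall fun t => ?_)
  · apply Continuous.aestronglyMeasurable
    apply Continuous.div (by fun_prop)
    · exact continuous_normSq.comp (by fun_prop)
    · intro t
      rw [hn]; exact (hp t).ne'
  · rw [hn, Real.norm_of_nonneg (by positivity), div_le_iff₀ (hp t)]
    have h1 : (1 + 2 * l.re ^ 2) / l.im ^ 2 * ((t - l.re) ^ 2 + l.im ^ 2) ≥ 1 + 2 * l.re ^ 2 := by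
      rw [mul_add, div_mul_cancel₀ _ (by positivity)]
      have : 0 ≤ (1 + 2 * l.re ^ 2) / l.im ^ 2 * (t - l.re) ^ 2 := by positivity
      linarith
    have h2 : 1 + t ^ 2 ≤ (2 + (1 + 2 * l.re ^ 2) / l.im ^ 2) * ((t - l.re) ^ 2 + l.im ^ 2) := by
      rw [add_mul]
      nlinarith [sq_nonneg (t - 2 * l.re), sq_nonneg l.im]
    calc (1 + t ^ 2) * l.im ≤ (2 + (1 + 2 * l.re ^ 2) / l.im ^ 2) * ((t - l.re) ^ 2 + l.im ^ 2) * l.im := by gcongr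
      _ = _ := by ring

lemma herglotz_ball (F : ℂ → ℂ) (B : ℝ) (hB : 0 ≤ B) (ν : Measure ℝ) [IsFiniteMeasure ν]
    (hrep : ∀ l : ℂ, 0 < l.im →
      (F l).im = B * l.im + ∫ t : ℝ, (1 + t ^ 2) * l.im / normSq (t - l) ∂ν) (x y : ℝ) (hy : 0 < y) :
    ν (Metric.closedBall x y) / volume (Metric.closedBall x y) ≤ ENNReal.ofReal (F (x + y * I)).im := by
  set l : ℂ := x + y * I with hl
  have hli : l.im = y := by simp [hl]
  have hlr : l.re = x := by simp [hl]
  have hlp : 0 < l.im := by rw [hli]; exact hy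
  have hn : ∀ t : ℝ, normSq ((t:ℂ) - l) = (t - x) ^ 2 + y ^ 2 := fun t => by
    rw [← hli, ← hlr]; simp [normSq_apply]; ring
  have hki := kernel_integrable ν l hlp
  have h1 : ν.real (Metric.closedBall x y) * (2 * y)⁻¹ ≤ ∫ t : ℝ, (1 + t ^ 2) * l.im / normSq (t - l) ∂ν := by
    calc ν.real (Metric.closedBall x y) * (2 * y)⁻¹ = ∫ t in Metric.closedBall x y, (2 * y)⁻¹ ∂ν := by simp
      _ ≤ ∫ t in Metric.closedBall x y, (1 + t ^ 2) * l.im / normSq (t - l) ∂ν := by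
        apply setIntegral_mono_on (integrable_const _) hki.integrableOn measurableSet_closedBall
        intro t ht
        rw [hn, hli]
        rw [Metric.mem_closedBall, Real.dist_eq] at ht
        have h2 : (t - x) ^ 2 ≤ y ^ 2 := sq_le_sq' (by linarith [neg_abs_le (t - x)]) (by linarith [le_abs_self (t - x)])
        rw [inv_eq_one_div, div_le_div_iff₀ (by positivity) (by positivity)]
        nlinarith [mul_nonneg (sq_nonneg t) (sq_nonneg y)]
      _ ≤ _ := by
        apply setIntegral_le_integral hki
        refine Eventually.of_forall fun t => ?_
        have := normSq_nonneg ((t:ℂ) - l)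
        show 0 ≤ (1 + t ^ 2) * l.im / normSq (t - l)
        positivity
  have h2 := hrep l hlp
  have h3 : ν.real (Metric.closedBall x y) * (2 * y)⁻¹ ≤ (F l).im := by
    rw [h2]
    have : 0 ≤ B * l.im := by positivity
    linarith
  rw [Real.volume_closedBall]
  rw [← ofReal_measureReal, ← ENNReal.ofReal_div_of_pos (by positivity)]
  apply ENNReal.ofReal_le_ofReal
  rw [div_eq_mul_inv]
  exact h3

open Topology in
lemma herglotz_null (F : ℂ → ℂ) (B : ℝ) (hB : 0 ≤ B) (ν : Measure ℝ) [IsFiniteMeasure ν]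
    (hrep : ∀ l : ℂ, 0 < l.im →
      (F l).im = B * l.im + ∫ t : ℝ, (1 + t ^ 2) * l.im / normSq (t - l) ∂ν)
    (U : Set ℝ) (hU : ∀ x ∈ U, Tendsto (fun y : ℝ => (F (x + y * I)).im) (𝓝[>] 0) (𝓝 0)) : ν U = 0 := by
  have h1 := Besicovitch.ae_tendsto_rnDeriv (volume : Measure ℝ) ν
  have h2 := Measure.rnDeriv_lt_top (volume : Measure ℝ) ν
  have h3 : ∀ᵐ x ∂ν, x ∉ U := by
    filter_upwards [h1, h2] with x hx1 hx2 hxU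
    have h4 : Tendsto (fun y : ℝ => ν (Metric.closedBall x y) / volume (Metric.closedBall x y)) (𝓝[>] 0) (𝓝 0) := by
      have h5 : Tendsto (fun y : ℝ => ENNReal.ofReal (F (x + y * I)).im) (𝓝[>] 0) (𝓝 0) := by
        have := ENNReal.tendsto_ofReal (hU x hxU)
        simpa using this
      refine tendsto_of_tendsto_of_tendsto_of_le_of_le' tendsto_const_nhds h5
        (Eventually.of_forall fun _ => zero_le) ?_
      filter_upwards [self_mem_nhdsWithin] with y hy
      exact herglotz_ball F B hB ν hrep x y hy
    have h6 := tendsto_inv_iff.mpr h4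
    rw [ENNReal.inv_zero] at h6
    have h7 : Tendsto (fun y : ℝ => volume (Metric.closedBall x y) / ν (Metric.closedBall x y)) (𝓝[>] 0) (𝓝 ⊤) := by
      refine h6.congr' ?_
      filter_upwards [self_mem_nhdsWithin] with y hy
      have hy' : (0:ℝ) < y := hy
      rw [ENNReal.inv_div]
      · left; rw [Real.volume_closedBall]; exact ENNReal.ofReal_ne_top
      · left; rw [Real.volume_closedBall]; simp [hy']
    have := tendsto_nhds_unique hx1 h7
    rw [this] at hx2
    exact lt_irrefl _ hx2
  rw [ae_iff] at h3
  simpa using h3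

lemma const_of_im_zero (G : ℂ → ℂ) (hG : DifferentiableOn ℂ G {z : ℂ | 0 < z.im})
    (h0 : ∀ z : ℂ, 0 < z.im → (G z).im = 0) : ∃ A : ℝ, ∀ z : ℂ, 0 < z.im → G z = A := by
  have hopen : IsOpen {z : ℂ | 0 < z.im} := isOpen_lt continuous_const continuous_im
  have han : AnalyticOnNhd ℂ G {z : ℂ | 0 < z.im} := hG.analyticOnNhd hopen
  have hconn : IsPreconnected {z : ℂ | 0 < z.im} := (convex_halfSpace_im_gt 0).isPreconnected
  rcases han.is_constant_or_isOpen hconn with ⟨w, hw⟩ | h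
  · refine ⟨w.re, fun z hz => ?_⟩
    rw [hw z hz]
    have := h0 z hz
    rw [hw z hz] at this
    apply Complex.ext <;> simp [this]
  · exfalso
    have h1 := h _ subset_rfl hopen
    have hI : G I ∈ G '' {z : ℂ | 0 < z.im} := ⟨I, by simp, rfl⟩
    obtain ⟨ε, hε, hb⟩ := Metric.isOpen_iff.mp h1 _ hI
    have : G I + (ε / 2 : ℝ) * I ∈ G '' {z : ℂ | 0 < z.im} := by
      apply hb
      simp [abs_of_pos hε]
      linarith
    obtain ⟨z, hz, hz2⟩ := this
    have h3 := h0 z hz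
    have h4 := h0 I (by simp)
    rw [hz2] at h3
    simp [h4] at h3
    linarith

open Topology in
lemma herglotz_rep (F : ℂ → ℂ) (hF : DifferentiableOn ℂ F {z : ℂ | 0 < z.im})
    (hpos : ∀ z : ℂ, 0 < z.im → 0 ≤ (F z).im) (K : Set ℝ) (hK : IsCompact K)
    (hU : ∀ x ∉ K, Tendsto (fun y : ℝ => (F (x + y * I)).im) (𝓝[>] 0) (𝓝 0)) :
    ∃ A B : ℝ, ∃ σ : Measure ℝ, IsFiniteMeasure σ ∧ σ Kᶜ = 0 ∧ ∀ l : ℂ, 0 < l.im →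
      F l = A + B * l + ∫ t : ℝ, ((t:ℂ) - l)⁻¹ ∂σ := by
  obtain ⟨B, hB, ν, hν, hrep⟩ := halfplane_herglotz F hF hpos
  have hnull : ν Kᶜ = 0 := herglotz_null F B hB ν hrep Kᶜ (fun x hx => hU x hx)
  let σ : Measure ℝ := ν.withDensity (fun t => ENNReal.ofReal (1 + t ^ 2))
  have hm : Measurable (fun t : ℝ => ENNReal.ofReal (1 + t ^ 2)) := by fun_prop
  have hfin : IsFiniteMeasure σ := by
    obtain ⟨C, hC⟩ := hK.isBounded.exists_norm_le
    apply isFiniteMeasure_withDensity_ofReal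
    apply Integrable.hasFiniteIntegral
    refine Integrable.of_bound (C := 1 + C ^ 2) (by fun_prop) ?_
    have : ∀ᵐ t ∂ν, t ∈ K := by rw [ae_iff]; exact hnull
    filter_upwards [this] with t ht
    have h1 := hC t ht
    rw [Real.norm_of_nonneg (by positivity)]
    have h2 := abs_le.mp h1
    have := sq_le_sq' h2.1 h2.2
    linarith
  have hσ : σ Kᶜ = 0 := withDensity_absolutelyContinuous _ _ hnull
  have hne : ∀ l : ℂ, 0 < l.im → ∀ t ∈ K, (t:ℂ) ≠ l := fun l hl t _ h => by
    rw [← h] at hl; simp at hl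
  let S : ℂ → ℂ := fun l => ∫ t : ℝ, ((t:ℂ) - l)⁻¹ ∂σ
  have hS : DifferentiableOn ℂ S {z : ℂ | 0 < z.im} := fun l hl =>
    (stieltjes_hasDerivAt σ K hK.isClosed hσ l (hne l hl)).differentiableAt.differentiableWithinAt
  have hSim : ∀ l : ℂ, 0 < l.im → (S l).im = ∫ t : ℝ, (1 + t ^ 2) * l.im / normSq (t - l) ∂ν := by
    intro l hl
    have h1 := Complex.imCLM.integral_comp_comm (stieltjes_integrable σ K hK.isClosed hσ l (hne l hl))
    simp only [imCLM_apply] at h1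
    rw [← h1]
    simp only [σ]
    rw [integral_withDensity_eq_integral_toReal_smul hm (Eventually.of_forall fun _ => ENNReal.ofReal_lt_top)]
    congr 1
    ext t
    rw [ENNReal.toReal_ofReal (by positivity), inv_im, smul_eq_mul]
    simp
    ring
  obtain ⟨A, hA⟩ := const_of_im_zero (fun l => F l - B * l - S l) (by fun_prop) (by
    intro l hl
    simp [hrep l hl, hSim l hl])
  refine ⟨A, B, σ, hfin, hσ, fun l hl => ?_⟩
  rw [← hA l hl]
  simp only [S]; ring


open InnerProductSpace in
lemma jacobi_selfAdjoint (a b : ℤ → ℝ) (T : lp (fun _ : ℤ => ℂ) 2 →L[ℂ] lp (fun _ : ℤ => ℂ) 2)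
    (hT : IsJacobiOperator a b T) : IsSelfAdjoint T := by
  rw [ContinuousLinearMap.isSelfAdjoint_iff']
  ext u n
  have h1 : (ContinuousLinearMap.adjoint T u) n = inner ℂ (lp.single 2 n (1:ℂ)) (ContinuousLinearMap.adjoint T u) := by
    rw [lp.inner_single_left]; simp
  have h2 : T (lp.single 2 n (1:ℂ)) = lp.single 2 (n-1) ((a (n-1) : ℝ) : ℂ) + lp.single 2 (n+1) ((a n : ℝ):ℂ)
      + lp.single 2 n ((b n : ℝ) : ℂ) := by
    ext m
    rw [hT]
    simp only [lp.coeFn_add, Pi.add_apply, lp.single_apply, Pi.single_apply]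
    by_cases e1 : m = n - 1
    · subst e1
      have q1 : ¬ (n - 1 - 1 = n) := by omega
      have q2 : ¬ (n - 1 = n + 1) := by omega
      simp [q1, q2]
    · by_cases e2 : m = n + 1
      · subst e2
        have q1 : ¬ (n + 1 + 1 = n) := by omega
        have q2 : ¬ (n + 1 = n - 1) := by omega
        simp [q1, q2]
      · by_cases e3 : m = n
        · subst e3
          simp [e1]
        · have h1 : ¬ (m + 1 = n) := by omega
          have h2 : ¬ (m - 1 = n) := by omega
          simp [e1, e2, e3, h1, h2]
  rw [h1, ContinuousLinearMap.adjoint_inner_right, h2, inner_add_left, inner_add_left,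
    lp.inner_single_left, lp.inner_single_left, lp.inner_single_left, hT]
  simp
  ring

lemma jacobi_resolventSet (R : ℝ) (a b : ℤ → ℝ) (T : lp (fun _ : ℤ => ℂ) 2 →L[ℂ] lp (fun _ : ℤ => ℂ) 2)
    (hT : IsJacobiOperator a b T) (hR : ‖T‖ ≤ R) (z : ℂ) (hz : z.im ≠ 0 ∨ R < |z.re|) :
    z ∈ resolventSet ℂ T := by
  by_contra hcon
  have hs : z ∈ spectrum ℂ T := hcon
  have h1 := (jacobi_selfAdjoint a b T hT).mem_spectrum_eq_re hs
  rcases hz with hz | hz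
  · apply hz; rw [h1]; simp
  · have h2 := spectrum.norm_le_norm_mul_of_mem hs
    have h3 : ‖(1 : lp (fun _ : ℤ => ℂ) 2 →L[ℂ] lp (fun _ : ℤ => ℂ) 2)‖ ≤ 1 := ContinuousLinearMap.norm_id_le
    have h4 := abs_re_le_norm z
    nlinarith [norm_nonneg T, norm_nonneg (1 : lp (fun _ : ℤ => ℂ) 2 →L[ℂ] lp (fun _ : ℤ => ℂ) 2)]

lemma resolvent_eq (T : lp (fun _ : ℤ => ℂ) 2 →L[ℂ] lp (fun _ : ℤ => ℂ) 2) (z : ℂ)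
    (hz : z ∈ resolventSet ℂ T) (v : lp (fun _ : ℤ => ℂ) 2) :
    z • (resolvent T z v) - T (resolvent T z v) = v := by
  have h : (algebraMap ℂ _ z - T) * resolvent T z = 1 := Ring.mul_inverse_cancel _ hz
  have h2 := congrArg (fun A : lp (fun _ : ℤ => ℂ) 2 →L[ℂ] lp (fun _ : ℤ => ℂ) 2 => A v) h
  simpa [Algebra.algebraMap_eq_smul_one] using h2

lemma resolvent_eq_left (T : lp (fun _ : ℤ => ℂ) 2 →L[ℂ] lp (fun _ : ℤ => ℂ) 2) (z : ℂ)
    (hz : z ∈ resolventSet ℂ T) (v : lp (fun _ : ℤ => ℂ) 2) :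
    resolvent T z (z • v - T v) = v := by
  have h : resolvent T z * (algebraMap ℂ _ z - T) = 1 := Ring.inverse_mul_cancel _ hz
  have h2 := congrArg (fun A : lp (fun _ : ℤ => ℂ) 2 →L[ℂ] lp (fun _ : ℤ => ℂ) 2 => A v) h
  simpa [Algebra.algebraMap_eq_smul_one] using h2

lemma eval_diff (T : lp (fun _ : ℤ => ℂ) 2 →L[ℂ] lp (fun _ : ℤ => ℂ) 2) (z : ℂ)
    (hz : z ∈ resolventSet ℂ T) (v : lp (fun _ : ℤ => ℂ) 2) (n : ℤ) :
    DifferentiableAt ℂ (fun z => (resolvent T z v) n) z := by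
  have h := (spectrum.hasDerivAt_resolvent_const_left hz).differentiableAt
  have h2 : DifferentiableAt ℂ (fun z => innerSL ℂ (lp.single 2 n (1:ℂ)) (resolvent T z v)) z := by
    apply (innerSL ℂ (lp.single 2 n (1:ℂ) : lp (fun _ : ℤ => ℂ) 2)).differentiableAt.comp z
    exact h.clm_apply (differentiableAt_const v)
  simpa [lp.inner_single_left] using h2

lemma eval_tendsto {ι : Type*} {l : Filter ι} {f : ι → lp (fun _ : ℤ => ℂ) 2} {v : lp (fun _ : ℤ => ℂ) 2}
    (h : Tendsto f l (nhds v)) (n : ℤ) : Tendsto (fun i => f i n) l (nhds (v n)) := by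
  have h2 := ((innerSL ℂ (lp.single 2 n (1:ℂ) : lp (fun _ : ℤ => ℂ) 2)).continuous.tendsto v).comp h
  simpa [Function.comp_def, lp.inner_single_left] using h2

lemma weyl (a b : ℤ → ℝ) (ha : ∀ n, 0 < a n) (T : lp (fun _ : ℤ => ℂ) 2 →L[ℂ] lp (fun _ : ℤ => ℂ) 2)
    (hT : IsJacobiOperator a b T) (z : ℂ) (hz : z ∈ resolventSet ℂ T) (fp fm : ℤ → ℂ)
    (hp : JacobiSolution a b z fp) (hp2 : SquareSummableAtTop fp) (hp0 : fp 0 ≠ 0)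
    (hm : JacobiSolution a b z fm) (hm2 : SquareSummableAtBot fm) (hm0 : fm 0 ≠ 0) (g0 g1 : ℂ)
    (hg0 : g0 = (resolvent T z (lp.single 2 0 (1:ℂ))) 0)
    (hg1 : g1 = (resolvent T z (lp.single 2 0 (1:ℂ))) 1) :
    g0 ≠ 0 ∧ -(fp 1 / (a 0 * fp 0)) = -(g1 / (a 0 * g0)) ∧
      fm 1 / (a 0 * fm 0) = (a 0 * g1 + 1) / (a 0 ^ 2 * g0) := by
  let v : ℤ → ℂ := fun n => if 0 ≤ n then fp n / fp 0 else fm n / fm 0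
  have hvp : ∀ n : ℤ, 0 ≤ n → v n = fp n / fp 0 := fun n hn => by simp [v, hn]
  have hvm : ∀ n : ℤ, n ≤ 0 → v n = fm n / fm 0 := fun n hn => by
    by_cases h : n = 0
    · subst h; simp [v, hp0, hm0]
    · have : ¬ (0 ≤ n) := by omega
      simp [v, this]
  have hv : Memℓp v 2 := by
    apply memℓp_gen
    apply Summable.of_nat_of_neg
    · have : Summable fun n : ℕ => ‖fp n‖ ^ 2 * (‖fp 0‖ ^ 2)⁻¹ := hp2.mul_right _
      refine this.congr fun n => ?_
      rw [hvp _ (by positivity), norm_div]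
      norm_num
      rw [div_pow]; rfl
    · have : Summable fun n : ℕ => ‖fm (-(n:ℤ))‖ ^ 2 * (‖fm 0‖ ^ 2)⁻¹ := hm2.mul_right _
      refine this.congr fun n => ?_
      rw [hvm _ (by simp), norm_div]
      norm_num
      rw [div_pow]; rfl
  let V : lp (fun _ : ℤ => ℂ) 2 := ⟨v, hv⟩
  have hV : ∀ n, V n = v n := fun n => rfl
  set c : ℂ := a 0 * (fp 1 / fp 0 - fm 1 / fm 0) with hc
  have key : z • V - T V = (-c) • lp.single 2 0 (1:ℂ) := by
    ext n
    simp only [lp.coeFn_sub, lp.coeFn_smul, Pi.sub_apply, Pi.smul_apply, lp.single_apply, smul_eq_mul]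
    rw [hT, hV, hV, hV]
    by_cases h0 : n = 0
    · subst h0
      rw [hvp (0+1) (by norm_num), hvm (0-1) (by norm_num), hvp 0 le_rfl, Pi.single_eq_same]
      have e := hm 0
      simp only [zero_add, zero_sub] at e ⊢
      rw [hc]
      field_simp
      linear_combination (-1:ℂ) * (fp 0) * e
    · rw [Pi.single_eq_of_ne h0]
      by_cases h1 : 0 < n
      · rw [hvp (n+1) (by omega), hvp (n-1) (by omega), hvp n (by omega)]
        have e := hp n
        field_simp
        linear_combination (-1:ℂ) * e
      · rw [hvm (n+1) (by omega), hvm (n-1) (by omega), hvm n (by omega)]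
        have e := hm n
        field_simp
        linear_combination (-1:ℂ) * e
  have h1 := resolvent_eq_left T z hz V
  rw [key, map_smul] at h1
  have e0 : v 0 = -c * g0 := by rw [← hV, ← h1, hg0]; rfl
  have e1 : v 1 = -c * g1 := by rw [← hV, ← h1, hg1]; rfl
  rw [hvp 0 le_rfl, div_self hp0] at e0
  rw [hvp 1 (by norm_num)] at e1
  have hg : g0 ≠ 0 := by
    intro h; rw [h] at e0; simp at e0
  have ha0 : (a 0 : ℂ) ≠ 0 := by exact_mod_cast (ha 0).ne'
  have hcg : c = - g0⁻¹ := by field_simp; linear_combination e0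
  have q1 : fp 1 / fp 0 = g1 / g0 := by rw [e1, hcg]; field_simp
  have q2 : fm 1 / fm 0 = g1 / g0 + 1 / (a 0 * g0) := by
    have : fm 1 / fm 0 = fp 1 / fp 0 - c / a 0 := by rw [hc]; field_simp; ring
    rw [this, q1, hcg]; field_simp; ring
  refine ⟨hg, ?_, ?_⟩
  · have : fp 1 / (a 0 * fp 0) = (fp 1 / fp 0) / a 0 := by field_simp
    rw [this, q1]; field_simp
  · have : fm 1 / (a 0 * fm 0) = (fm 1 / fm 0) / a 0 := by field_simp
    rw [this, q2]; field_simp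

lemma inner_T_real (a b : ℤ → ℝ) (T : lp (fun _ : ℤ => ℂ) 2 →L[ℂ] lp (fun _ : ℤ => ℂ) 2)
    (hT : IsJacobiOperator a b T) (w : lp (fun _ : ℤ => ℂ) 2) : (inner ℂ w (T w)).im = 0 := by
  have h := (jacobi_selfAdjoint a b T hT).isSymmetric
  have h1 := h w w
  have h2 : starRingEnd ℂ (inner ℂ w (T w)) = inner ℂ (T w) w := inner_conj_symm (𝕜 := ℂ) (T w) w
  have h3 : starRingEnd ℂ (inner ℂ w (T w)) = inner ℂ w (T w) := h2.trans h1
  exact conj_eq_iff_im.mp h3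

lemma mminus_im (a b : ℤ → ℝ) (ha : ∀ n, 0 < a n) (T : lp (fun _ : ℤ => ℂ) 2 →L[ℂ] lp (fun _ : ℤ => ℂ) 2)
    (hT : IsJacobiOperator a b T) (z : ℂ) (hz : 0 < z.im) (fm : ℤ → ℂ)
    (hm : JacobiSolution a b z fm) (hm2 : SquareSummableAtBot fm) (hm0 : fm 0 ≠ 0) :
    0 < (fm 1 / (a 0 * fm 0)).im := by
  let w : ℤ → ℂ := fun n => if n ≤ 0 then fm n / fm 0 else 0
  have hwm : ∀ n : ℤ, n ≤ 0 → w n = fm n / fm 0 := fun n hn => by simp [w, hn]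
  have hwp : ∀ n : ℤ, 0 < n → w n = 0 := fun n hn => by simp [w, hn]
  have hw : Memℓp w 2 := by
    apply memℓp_gen
    apply Summable.of_nat_of_neg
    · apply summable_of_ne_finset_zero (s := {0})
      intro n hn
      rw [hwp _ (by simp at hn; omega)]
      simp
    · have : Summable fun n : ℕ => ‖fm (-(n:ℤ))‖ ^ 2 * (‖fm 0‖ ^ 2)⁻¹ := hm2.mul_right _
      refine this.congr fun n => ?_
      rw [hwm _ (by simp), norm_div]
      norm_num
      rw [div_pow]; rfl
  let W : lp (fun _ : ℤ => ℂ) 2 := ⟨w, hw⟩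
  have hW : ∀ n, W n = w n := fun n => rfl
  set q := fm 1 / fm 0 with hq
  have key : T W = z • W + lp.single 2 0 (-(a 0 : ℂ) * q) + lp.single 2 1 (a 0 : ℂ) := by
    ext n
    simp only [lp.coeFn_add, lp.coeFn_smul, Pi.add_apply, Pi.smul_apply, lp.single_apply, smul_eq_mul]
    rw [hT, hW, hW, hW]
    by_cases h0 : n = 0
    · subst h0
      rw [hwp (0+1) (by norm_num), hwm (0-1) (by norm_num), hwm 0 le_rfl, Pi.single_eq_same,
        Pi.single_eq_of_ne (by norm_num), hq]
      have e := hm 0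
      simp only [zero_add, zero_sub] at e ⊢
      field_simp
      linear_combination e
    · rw [Pi.single_eq_of_ne h0]
      by_cases h1 : n = 1
      · subst h1
        rw [hwp (1+1) (by norm_num), hwm (1-1) (by norm_num), hwp 1 (by norm_num), Pi.single_eq_same]
        simp [hm0]
      · rw [Pi.single_eq_of_ne h1]
        by_cases h2 : 0 < n
        · rw [hwp (n+1) (by omega), hwp (n-1) (by omega), hwp n (by omega)]
          simp
        · rw [hwm (n+1) (by omega), hwm (n-1) (by omega), hwm n (by omega)]
          have e := hm n
          field_simp
          linear_combination e
  have h1 := inner_T_real a b T hT W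
  rw [key, inner_add_right, inner_add_right, inner_smul_right, lp.inner_single_right, lp.inner_single_right,
    hW, hW, hwm 0 le_rfl, hwp 1 (by norm_num), inner_self_eq_norm_sq_to_K] at h1
  have hWn : 0 < ‖W‖ ^ 2 := by
    have : W ≠ 0 := by
      intro h
      have h2 : W 0 = 0 := by rw [h]; rfl
      rw [hW, hwm 0 le_rfl, div_self hm0] at h2
      exact one_ne_zero h2
    positivity
  have h2 : z.im * ‖W‖ ^ 2 = a 0 * q.im := by
    simp [hm0, ← ofReal_pow] at h1
    linarith
  have h3 : fm 1 / (a 0 * fm 0) = q / (a 0 : ℂ) := by rw [hq]; field_simp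
  rw [h3, div_ofReal_im]
  apply div_pos _ (ha 0)
  have := mul_pos hz hWn
  rw [h2] at this
  exact (mul_pos_iff_of_pos_left (ha 0)).mp this

lemma green_real (R : ℝ) (a b : ℤ → ℝ) (T : lp (fun _ : ℤ => ℂ) 2 →L[ℂ] lp (fun _ : ℤ => ℂ) 2)
    (hT : IsJacobiOperator a b T) (hR : ‖T‖ ≤ R) (E : ℝ) (hE : R < |E|) (g0 : ℂ)
    (hg0 : g0 = (resolvent T (E:ℂ) (lp.single 2 0 (1:ℂ))) 0) :
    g0.im = 0 ∧ 0 < E * g0.re := by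
  have hz : (E:ℂ) ∈ resolventSet ℂ T := jacobi_resolventSet R a b T hT hR E (by right; simpa using hE)
  set u := resolvent T (E:ℂ) (lp.single 2 0 (1:ℂ)) with hu
  have h1 := resolvent_eq T E hz (lp.single 2 0 (1:ℂ))
  rw [← hu] at h1
  have h2 : starRingEnd ℂ g0 = inner ℂ u ((E:ℂ) • u - T u) := by
    rw [h1, lp.inner_single_right, ← hg0]; simp
  rw [inner_sub_right, inner_smul_right, inner_self_eq_norm_sq_to_K] at h2
  have h3 := inner_T_real a b T hT u
  have him := congrArg Complex.im h2
  have hre := congrArg Complex.re h2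
  simp [← ofReal_pow, h3] at him hre
  refine ⟨him, ?_⟩
  have hu0 : 0 < ‖u‖ ^ 2 := by
    have : u ≠ 0 := by
      intro h
      rw [h] at h1
      have h4 := congrArg (fun w : lp (fun _ : ℤ => ℂ) 2 => w 0) h1
      simp at h4
    positivity
  have h5 : |(inner ℂ u (T u)).re| ≤ R * ‖u‖ ^ 2 := by
    calc |(inner ℂ u (T u)).re| ≤ ‖inner ℂ u (T u)‖ := abs_re_le_norm _
      _ ≤ ‖u‖ * ‖T u‖ := norm_inner_le_norm _ _
      _ ≤ ‖u‖ * (‖T‖ * ‖u‖) := by gcongr; exact T.le_opNorm u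
      _ ≤ ‖u‖ * (R * ‖u‖) := by gcongr
      _ = _ := by ring
  rw [hre]
  have h6 : |E * (inner ℂ u (T u)).re| ≤ |E| * (R * ‖u‖ ^ 2) := by rw [abs_mul]; gcongr
  have h7 := le_abs_self (E * (inner ℂ u (T u)).re)
  have h8 : |E| * |E| = E * E := abs_mul_abs_self E
  have hR0 : 0 ≤ R := (norm_nonneg T).trans hR
  have h9 : |E| * (R * ‖u‖ ^ 2) < |E| * (|E| * ‖u‖ ^ 2) := by
    have : 0 < |E| := by linarith
    gcongr
  nlinarith

open Bornology in
lemma green_asymp (a b : ℤ → ℝ) (T : lp (fun _ : ℤ => ℂ) 2 →L[ℂ] lp (fun _ : ℤ => ℂ) 2)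
    (hT : IsJacobiOperator a b T) :
    Tendsto (fun z : ℂ => z * (resolvent T z (lp.single 2 0 (1:ℂ))) 0) (cobounded ℂ) (nhds 1) ∧
    Tendsto (fun z : ℂ => z ^ 2 * (resolvent T z (lp.single 2 0 (1:ℂ))) 1) (cobounded ℂ) (nhds (a 0)) := by
  have h0 := spectrum.resolvent_tendsto_cobounded (𝕜 := ℂ) T
  set d : lp (fun _ : ℤ => ℂ) 2 := lp.single 2 0 (1:ℂ) with hd
  have hu : Tendsto (fun z : ℂ => resolvent T z d) (cobounded ℂ) (nhds 0) := by
    have h1 := ((ContinuousLinearMap.apply ℂ (lp (fun _ : ℤ => ℂ) 2) d).continuous.tendsto 0).comp h0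
    simpa [Function.comp_def] using h1
  have hres : ∀ᶠ z in cobounded ℂ, z ∈ resolventSet ℂ T := by
    filter_upwards [tendsto_norm_cobounded_atTop.eventually_gt_atTop (‖T‖)] with z hz
    by_contra hcon
    have hs : z ∈ spectrum ℂ T := hcon
    have h2 := spectrum.norm_le_norm_mul_of_mem hs
    have h3 : ‖(1 : lp (fun _ : ℤ => ℂ) 2 →L[ℂ] lp (fun _ : ℤ => ℂ) 2)‖ ≤ 1 := ContinuousLinearMap.norm_id_le
    nlinarith [norm_nonneg T, norm_nonneg (1 : lp (fun _ : ℤ => ℂ) 2 →L[ℂ] lp (fun _ : ℤ => ℂ) 2)]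
  have hzu : Tendsto (fun z : ℂ => z • resolvent T z d) (cobounded ℂ) (nhds d) := by
    have h1 : Tendsto (fun z : ℂ => T (resolvent T z d) + d) (cobounded ℂ) (nhds (T 0 + d)) :=
      ((T.continuous.tendsto 0).comp hu).add_const d
    rw [map_zero, zero_add] at h1
    refine h1.congr' ?_
    filter_upwards [hres] with z hz
    have := resolvent_eq T z hz d
    rw [sub_eq_iff_eq_add] at this
    rw [this, add_comm]
  constructor
  · have := eval_tendsto hzu 0
    simpa [hd] using this
  · have h2 : Tendsto (fun z : ℂ => T (z • resolvent T z d)) (cobounded ℂ) (nhds (T d)) :=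
      (T.continuous.tendsto d).comp hzu
    have h3 := eval_tendsto h2 1
    have h4 : (T d) 1 = a 0 := by
      rw [hT, hd]; simp
    rw [h4] at h3
    refine h3.congr' ?_
    filter_upwards [hres] with z hz
    have := resolvent_eq T z hz d
    have h5 := congrArg (fun w : lp (fun _ : ℤ => ℂ) 2 => w 1) this
    have h6 : z * (resolvent T z d) 1 - (T (resolvent T z d)) 1 = 0 := by
      refine Eq.trans h5 ?_
      rw [hd]; simp
    simp only [map_smul, lp.coeFn_smul, Pi.smul_apply, smul_eq_mul]
    linear_combination (-z) * h6


open Bornology in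
lemma jacobi_mq (R : ℝ) (a b : ℤ → ℝ) (hJ : MemMR R a b) : ∃ p q : ℂ → ℂ,
    (∀ mp, IsJacobiMPlus a b mp → ∀ z : ℂ, 0 < z.im → mp z = p z) ∧
    (∀ z : ℂ, 0 < z.im → 0 < (q z).im) ∧
    DifferentiableOn ℂ q {z : ℂ | 0 < z.im} ∧
    ReflectionlessOn22 p q ∧
    (∀ E : ℝ, R < |E| → ContinuousAt p E ∧ ContinuousAt q E ∧ (p E + q E).im = 0 ∧
      0 < E * (p E + q E).re) ∧
    Tendsto (fun z => z * p z) (cobounded ℂ) (nhds (-1)) := by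
  obtain ⟨ha, ⟨T, hT, hTR⟩, mp0, mm, hmp0, hmm, hrefl⟩ := hJ
  let g0 : ℂ → ℂ := fun z => (resolvent T z (lp.single 2 0 (1:ℂ))) 0
  let g1 : ℂ → ℂ := fun z => (resolvent T z (lp.single 2 0 (1:ℂ))) 1
  have hres := jacobi_resolventSet R a b T hT hTR
  have ha0 : (a 0 : ℂ) ≠ 0 := by exact_mod_cast (ha 0).ne'
  have hd0 : ∀ z : ℂ, (z.im ≠ 0 ∨ R < |z.re|) → DifferentiableAt ℂ g0 z := fun z hz =>
    eval_diff T z (hres z hz) _ 0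
  have hd1 : ∀ z : ℂ, (z.im ≠ 0 ∨ R < |z.re|) → DifferentiableAt ℂ g1 z := fun z hz =>
    eval_diff T z (hres z hz) _ 1
  have hweyl : ∀ mp, IsJacobiMPlus a b mp → ∀ z : ℂ, 0 < z.im → g0 z ≠ 0 ∧
      mp z = -(g1 z / (a 0 * g0 z)) ∧ mm z = (a 0 * g1 z + 1) / (a 0 ^ 2 * g0 z) := by
    intro mp hmp z hz
    obtain ⟨fp, h1, h2, h3, h4⟩ := hmp z hz
    obtain ⟨fm, k1, k2, k3, k4⟩ := hmm z hz
    have := weyl a b ha T hT z (hres z (Or.inl hz.ne')) fp fm h1 h2 h3 k1 k2 k3 (g0 z) (g1 z) rfl rfl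
    rw [h4, k4]
    exact this
  refine ⟨fun z => -(g1 z / (a 0 * g0 z)), fun z => (a 0 * g1 z + 1) / (a 0 ^ 2 * g0 z),
    fun mp hmp z hz => (hweyl mp hmp z hz).2.1, ?_, ?_, ?_, ?_, ?_⟩
  · intro z hz
    show 0 < ((a 0 * g1 z + 1) / (a 0 ^ 2 * g0 z)).im
    rw [← (hweyl mp0 hmp0 z hz).2.2]
    obtain ⟨fm, k1, k2, k3, k4⟩ := hmm z hz
    rw [k4]
    exact mminus_im a b ha T hT z hz fm k1 k2 k3
  · intro z hz
    have hz' : z.im ≠ 0 ∨ R < |z.re| := Or.inl (ne_of_gt hz)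
    apply DifferentiableAt.differentiableWithinAt
    have e0 := hd0 z hz'
    have e1 := hd1 z hz'
    apply DifferentiableAt.div (by fun_prop) (by fun_prop)
    exact mul_ne_zero (pow_ne_zero 2 ha0) (hweyl mp0 hmp0 z hz).1
  · filter_upwards [hrefl] with x hx hx2
    refine (hx hx2).congr' ?_
    filter_upwards [self_mem_nhdsWithin] with y hy
    have := hweyl mp0 hmp0 (x + y * I) (by simpa using hy)
    rw [this.2.1, this.2.2]
  · intro E hE
    have hz' : (E:ℂ).im ≠ 0 ∨ R < |(E:ℂ).re| := Or.inr (by simpa using hE)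
    obtain ⟨k1, k2⟩ := green_real R a b T hT hTR E hE (g0 E) rfl
    have hgr : g0 E = ((g0 E).re : ℂ) := by apply Complex.ext <;> simp [k1]
    have hre : (g0 E).re ≠ 0 := by rintro h; rw [h] at k2; simp at k2
    have hne : g0 E ≠ 0 := by rw [hgr]; exact_mod_cast hre
    have e0 := (hd0 E hz').continuousAt
    have e1 := (hd1 E hz').continuousAt
    have hsum : -(g1 E / (a 0 * g0 E)) + (a 0 * g1 E + 1) / (a 0 ^ 2 * g0 E) = ((a 0 ^ 2 * (g0 E).re)⁻¹ : ℝ) := by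
      have : (((a 0 ^ 2 * (g0 E).re)⁻¹ : ℝ) : ℂ) = (a 0 ^ 2 * g0 E)⁻¹ := by
        rw [ofReal_inv, ofReal_mul, ← hgr]; simp
      rw [this]; field_simp; ring
    refine ⟨?_, ?_, ?_, ?_⟩
    · apply ContinuousAt.neg
      exact e1.div (continuousAt_const.mul e0) (mul_ne_zero ha0 hne)
    · exact ((continuousAt_const.mul e1).add continuousAt_const).div (continuousAt_const.mul e0)
        (mul_ne_zero (pow_ne_zero 2 ha0) hne)
    · simp only []
      rw [hsum, ofReal_im]
    · simp only []
      rw [hsum, ofReal_re, mul_inv]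
      have h1 : 0 < E * (g0 E).re⁻¹ := by
        have : E * (g0 E).re⁻¹ = (E * (g0 E).re) * ((g0 E).re⁻¹) ^ 2 := by field_simp
        rw [this]; positivity
      have h2 := ha 0
      have : E * ((a 0 ^ 2)⁻¹ * (g0 E).re⁻¹) = (a 0 ^ 2)⁻¹ * (E * (g0 E).re⁻¹) := by ring
      rw [this]; positivity
  · obtain ⟨h1, h2⟩ := green_asymp a b T hT
    have h3 : Tendsto (fun z : ℂ => -((z ^ 2 * g1 z) / (a 0 * (z * g0 z)))) (cobounded ℂ) (nhds (-((a 0 : ℂ) / (a 0 * 1)))) :=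
      (h2.div (h1.const_mul _) (by simpa using ha0)).neg
    rw [mul_one, div_self ha0] at h3
    refine h3.congr' ?_
    filter_upwards [eventually_ne_cobounded (0:ℂ)] with z hz
    field_simp

lemma cayley_bound (z : ℂ) (hz : 0 < z.im) : ‖(z - I) / (z + I)‖ ≤ 1 := by
  have h1 : z + I ≠ 0 := by
    intro h; have := congrArg Complex.im h; simp at this; linarith
  rw [norm_div, div_le_one (by positivity)]
  apply le_of_sq_le_sq _ (norm_nonneg _)
  rw [← normSq_eq_norm_sq, ← normSq_eq_norm_sq]
  simp [normSq_apply]; nlinarith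

lemma omega22_open : IsOpen Omega22 := by
  have : Omega22 = {z : ℂ | z.im ≠ 0} ∪ ({z : ℂ | -2 < z.re} ∩ {z : ℂ | z.re < 2}) := rfl
  rw [this]
  exact (isOpen_ne_fun continuous_im continuous_const).union
    ((isOpen_lt continuous_const continuous_re).inter (isOpen_lt continuous_re continuous_const))

lemma conj_holo (q : ℂ → ℂ) (hqd : DifferentiableOn ℂ q {z : ℂ | 0 < z.im}) :
    DifferentiableOn ℂ (fun z => -(starRingEnd ℂ (q (starRingEnd ℂ z)))) {z : ℂ | z.im < 0} := by
  intro z hz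
  apply DifferentiableAt.differentiableWithinAt
  have hopen : IsOpen {z : ℂ | 0 < z.im} := isOpen_lt continuous_const continuous_im
  have hz' : 0 < (starRingEnd ℂ z).im := by simpa using hz
  have h1 : DifferentiableAt ℂ q (starRingEnd ℂ z) := hqd.differentiableAt (hopen.mem_nhds hz')
  have h2 := h1.conj_conj
  rw [Complex.conj_conj] at h2
  exact h2.neg

open Topology in
lemma M_lower (M p q : ℂ → ℂ) (hM : DifferentiableOn ℂ M Omega22) (hMpos : ∀ z ∈ Omega22, 0 < (M z).im)
    (hMp : ∀ z : ℂ, 0 < z.im → M z = p z) (hq : ∀ z : ℂ, 0 < z.im → 0 < (q z).im)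
    (hqd : DifferentiableOn ℂ q {z : ℂ | 0 < z.im}) (hrefl : ReflectionlessOn22 p q) :
    ∀ z : ℂ, z.im < 0 → M z = -(starRingEnd ℂ (q (starRingEnd ℂ z))) := by
  let N : ℂ → ℂ := fun z => -(starRingEnd ℂ (q (starRingEnd ℂ z)))
  have hN : DifferentiableOn ℂ N {z : ℂ | z.im < 0} := conj_holo q hqd
  have hNpos : ∀ z : ℂ, z.im < 0 → 0 < (N z).im := fun z hz => by
    have := hq (starRingEnd ℂ z) (by simpa using hz)
    simpa [N] using this
  have hsub : {z : ℂ | z.im < 0} ⊆ Omega22 := fun z hz => Or.inl (ne_of_lt hz)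
  have hne : ∀ w : ℂ, 0 < w.im → w + I ≠ 0 := fun w hw h => by
    have := congrArg Complex.im h; simp at this; linarith
  have key := bdry_unique (fun z => (M z - I) / (M z + I) - (N z - I) / (N z + I)) (by
    have h1 := hM.mono hsub
    apply DifferentiableOn.sub
    · exact (h1.sub_const I).div (h1.add_const I) (fun z hz => hne _ (hMpos z (hsub hz)))
    · exact (hN.sub_const I).div (hN.add_const I) (fun z hz => hne _ (hNpos z hz))) 2 (by
    intro z hz
    refine (norm_sub_le _ _).trans ?_
    have h1 := cayley_bound _ (hMpos z (hsub hz))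
    have h2 := cayley_bound _ (hNpos z hz)
    linarith) (by
    filter_upwards [hrefl] with x hx hx2
    have hxO : (x:ℂ) ∈ Omega22 := Or.inr (by simpa using hx2)
    have hMc : ContinuousAt M x := (hM.differentiableAt (omega22_open.mem_nhds hxO)).continuousAt
    have t1 : Tendsto (fun y : ℝ => (x:ℂ) - y * I) (𝓝[>] 0) (𝓝 x) := by
      have : ContinuousAt (fun y : ℝ => (x:ℂ) - y * I) 0 := by fun_prop
      have := this.tendsto
      simp at this
      exact this.mono_left nhdsWithin_le_nhds
    have t2 : Tendsto (fun y : ℝ => (x:ℂ) + y * I) (𝓝[>] 0) (𝓝 x) := by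
      have : ContinuousAt (fun y : ℝ => (x:ℂ) + y * I) 0 := by fun_prop
      have := this.tendsto
      simp at this
      exact this.mono_left nhdsWithin_le_nhds
    have m1 := hMc.tendsto.comp t1
    have m2 := hMc.tendsto.comp t2
    have n1 : Tendsto (fun y : ℝ => N (x - y * I)) (𝓝[>] 0) (𝓝 (M x)) := by
      have := m2.sub (hx hx2)
      rw [sub_zero] at this
      refine this.congr' ?_
      filter_upwards [self_mem_nhdsWithin] with y hy
      have hy' : 0 < ((x:ℂ) + y * I).im := by simpa using hy
      simp only [Function.comp, N]
      rw [hMp _ hy']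
      have : starRingEnd ℂ ((x:ℂ) - y * I) = x + y * I := by simp
      rw [this]; ring
    have hw := hne _ (hMpos x hxO)
    have r1 := (m1.sub_const I).div (m1.add_const I) hw
    have r2 := (n1.sub_const I).div (n1.add_const I) hw
    have r := r1.sub r2
    rw [sub_self] at r
    exact r)
  intro z hz
  have h := key z hz
  have h1 := hne _ (hMpos z (hsub hz))
  have h2 := hne _ (hNpos z hz)
  show M z = N z
  rw [sub_eq_zero, div_eq_div_iff h1 h2] at h
  have h3 : 2 * I * (M z - N z) = 0 := by linear_combination h
  have h4 : (2:ℂ) * I ≠ 0 := by simp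
  exact sub_eq_zero.mp ((mul_eq_zero.mp h3).resolve_left h4)


lemma phi_im (l : ℂ) : (-l - 1 / l).im = l.im * (1 / normSq l - 1) := by
  simp [inv_im]; ring

lemma phi_mem (l : ℂ) (hl : 0 < l.im) : (-l - 1 / l) ∈ Omega22 := by
  have hn : 0 < normSq l := normSq_pos.mpr (by rintro rfl; simp at hl)
  by_cases h : normSq l = 1
  · right
    have h2 : (-l - 1 / l).re = -2 * l.re := by
      simp [inv_re, h]; ring
    rw [h2]
    rw [normSq_apply] at h
    constructor <;> nlinarith
  · left
    rw [phi_im]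
    apply mul_ne_zero hl.ne'
    rw [sub_ne_zero]
    intro h2
    apply h
    field_simp at h2
    exact h2.symm

lemma phi_abs (R r : ℝ) (hr0 : 0 < r) (hr1 : r ≤ 1) (hrR : r + 1/r = R) (x : ℝ) (hx : x ≠ 0) (hxr : |x| < r) :
    R < |-x - 1 / x| := by
  have h1 : |-x - 1/x| = |x| + 1 / |x| := by
    rcases lt_or_gt_of_ne hx with h | h
    · rw [abs_of_neg h, abs_of_pos]
      · rw [div_neg]; ring
      · have : 1 / x < 0 := one_div_neg.mpr h
        linarith
    · rw [abs_of_pos h, abs_of_neg]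
      · ring
      · have : 0 < 1 / x := one_div_pos.mpr h
        linarith
  rw [h1, ← hrR]
  have hs : 0 < |x| := abs_pos.mpr hx
  have h2 : |x| + 1 / |x| - (r + 1 / r) = (r - |x|) * (1 - r * |x|) / (r * |x|) := by
    field_simp; ring
  have h3 : 0 < (r - |x|) * (1 - r * |x|) / (r * |x|) := by
    apply div_pos _ (by positivity)
    apply mul_pos (by linarith)
    nlinarith
  linarith

lemma phi_abs_big (R r : ℝ) (hr0 : 0 < r) (hr1 : r ≤ 1) (hrR : r + 1/r = R) (x : ℝ) (hxr : 1 / r < |x|) :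
    R < |-x - 1 / x| := by
  have hx : x ≠ 0 := by
    rintro rfl
    have : 0 < 1 / r := by positivity
    simp at hxr; linarith [inv_pos.mpr hr0]
  have := phi_abs R r hr0 hr1 hrR (1 / x) (by simpa using hx) (by
    rw [abs_div, abs_one]
    rw [div_lt_comm₀ (abs_pos.mpr hx) hr0]
    exact hxr)
  have e : -(1 / x) - 1 / (1 / x) = -x - 1 / x := by field_simp; ring
  rwa [e] at this

open Topology Bornology in
lemma F_facts (R r : ℝ) (hr0 : 0 < r) (hr1 : r ≤ 1) (hrR : r + 1/r = R) (a b : ℤ → ℝ) (hJ : MemMR R a b)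
    (F : ℂ → ℂ) (hF : IsFFunction a b F) :
    DifferentiableOn ℂ F {z : ℂ | 0 < z.im} ∧ (∀ z : ℂ, 0 < z.im → 0 < (F z).im) ∧
    ∃ P Q : ℝ → ℝ, (∀ E : ℝ, R < |E| → 0 < E * (P E + Q E)) ∧
    (∀ x : ℝ, x ≠ 0 → |x| < r → Tendsto (fun y : ℝ => F (x + y * I)) (𝓝[>] 0) (𝓝 (P (-x - 1 / x) : ℂ))) ∧
    (∀ x : ℝ, 1 / r < |x| → Tendsto (fun y : ℝ => F (x + y * I)) (𝓝[>] 0) (𝓝 (-(Q (-x - 1 / x)) : ℂ))) ∧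
    Tendsto (fun y : ℝ => F (y * I) / (y * I)) (𝓝[>] 0) (𝓝 1) := by
  obtain ⟨p, q, hp, hq, hqd, hrefl, hE, hlim⟩ := jacobi_mq R a b hJ
  obtain ⟨mp, M, hmp, hM, hMpos, hMmp, hFM⟩ := hF
  have hMp : ∀ z : ℂ, 0 < z.im → M z = p z := fun z hz => (hMmp z hz).trans (hp mp hmp z hz)
  have hMq := M_lower M p q hM hMpos hMp hq hqd hrefl
  have hvert : ∀ x : ℝ, Tendsto (fun y : ℝ => (x:ℂ) + y * I) (𝓝[>] 0) (𝓝 x) := fun x => by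
    have : ContinuousAt (fun y : ℝ => (x:ℂ) + y * I) 0 := by fun_prop
    have := this.tendsto
    simp at this
    exact this.mono_left nhdsWithin_le_nhds
  have hreal : ∀ E : ℝ, R < |E| → (p E).im = 0 ∧ (q E).im = 0 := by
    intro E h
    obtain ⟨c1, c2, c3, c4⟩ := hE E h
    have i1 : 0 ≤ (p E).im := by
      have := (continuous_im.tendsto _).comp (c1.tendsto.comp (hvert E))
      refine ge_of_tendsto this ?_
      filter_upwards [self_mem_nhdsWithin] with y hy
      have hy' : 0 < ((E:ℂ) + y * I).im := by simpa using hy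
      have := hMpos _ (Or.inl hy'.ne')
      rw [hMp _ hy'] at this
      exact this.le
    have i2 : 0 ≤ (q E).im := by
      have := (continuous_im.tendsto _).comp (c2.tendsto.comp (hvert E))
      refine ge_of_tendsto this ?_
      filter_upwards [self_mem_nhdsWithin] with y hy
      have hy' : 0 < ((E:ℂ) + y * I).im := by simpa using hy
      exact (hq _ hy').le
    rw [add_im] at c3
    constructor <;> linarith
  have hphi : ∀ x : ℝ, x ≠ 0 → Tendsto (fun y : ℝ => -((x:ℂ) + y * I) - 1 / ((x:ℂ) + y * I)) (𝓝[>] 0)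
      (𝓝 ((-x - 1 / x : ℝ) : ℂ)) := by
    intro x hx
    have hx' : (x:ℂ) ≠ 0 := by exact_mod_cast hx
    have h := (hvert x).neg.sub (((tendsto_const_nhds (x := (1:ℂ))).div (hvert x) hx'))
    push_cast
    exact h
  refine ⟨?_, ?_, fun E => (p E).re, fun E => (q E).re, ?_, ?_, ?_, ?_⟩
  · have h1 : DifferentiableOn ℂ (fun l => M (-l - 1 / l)) {z : ℂ | 0 < z.im} := by
      apply hM.comp
      · intro l hl
        apply DifferentiableAt.differentiableWithinAt
        have : l ≠ 0 := by rintro rfl; simp at hl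
        fun_prop (disch := assumption)
      · intro l hl
        exact phi_mem l hl
    exact h1.congr (fun l hl => hFM l hl)
  · intro z hz
    rw [hFM z hz]
    exact hMpos _ (phi_mem z hz)
  · intro E h
    have := (hE E h).2.2.2
    rwa [add_re] at this
  · intro x hx hxr
    have hb := phi_abs R r hr0 hr1 hrR x hx hxr
    have hre := (hreal _ hb).1
    have e : (((p ((-x - 1 / x : ℝ):ℂ)).re : ℝ) : ℂ) = p ((-x - 1 / x : ℝ):ℂ) := by
      apply Complex.ext <;> simp only [ofReal_re, ofReal_im, hre]
    show Tendsto _ _ (𝓝 (((p ((-x - 1 / x : ℝ):ℂ)).re : ℝ) : ℂ))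
    rw [e]
    have hc := (hE _ hb).1
    refine (hc.tendsto.comp (hphi x hx)).congr' ?_
    have hsmall : ∀ᶠ y : ℝ in 𝓝[>] 0, normSq ((x:ℂ) + y * I) < 1 := by
      have h1 := (continuous_normSq.tendsto _).comp (hvert x)
      apply h1.eventually_lt_const
      rw [normSq_ofReal]
      have := abs_mul_abs_self x
      nlinarith [abs_nonneg x]
    filter_upwards [self_mem_nhdsWithin, hsmall] with y hy hs
    have hy' : 0 < ((x:ℂ) + y * I).im := by simpa using hy
    rw [hFM _ hy']
    simp only [Function.comp]
    rw [hMp]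
    rw [phi_im]
    apply mul_pos hy'
    have hn : 0 < normSq ((x:ℂ) + y * I) := normSq_pos.mpr (by intro h; rw [h] at hy'; simp at hy')
    rw [sub_pos, lt_div_iff₀ hn]
    linarith
  · intro x hxr
    have hb := phi_abs_big R r hr0 hr1 hrR x hxr
    have hx1 : 1 < |x| := by
      have : 1 ≤ 1 / r := by rw [le_div_iff₀ hr0]; linarith
      linarith
    have hx : x ≠ 0 := by rintro rfl; simp at hx1; linarith
    have hre := (hreal _ hb).2
    have e : -(((q ((-x - 1 / x : ℝ):ℂ)).re : ℝ) : ℂ) = -(starRingEnd ℂ (q (starRingEnd ℂ ((-x - 1 / x : ℝ):ℂ)))) := by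
      rw [conj_ofReal]
      apply Complex.ext <;> simp only [neg_re, neg_im, conj_re, conj_im, ofReal_re, ofReal_im, hre] <;> simp
    show Tendsto _ _ (𝓝 (-(((q ((-x - 1 / x : ℝ):ℂ)).re : ℝ) : ℂ)))
    rw [e]
    have hc := (hE _ hb).2.1
    have h0 := (continuous_conj.tendsto _).comp (hphi x hx)
    have h1 : Tendsto (fun z => q z) (𝓝 (starRingEnd ℂ ((-x - 1 / x : ℝ):ℂ))) (𝓝 (q (starRingEnd ℂ ((-x - 1 / x : ℝ):ℂ)))) := by
      rw [conj_ofReal]; exact hc.tendsto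
    have h2 := ((continuous_conj.tendsto _).comp (h1.comp h0)).neg
    refine h2.congr' ?_
    filter_upwards [self_mem_nhdsWithin] with y hy
    have hy' : 0 < ((x:ℂ) + y * I).im := by simpa using hy
    rw [hFM _ hy']
    simp only [Function.comp]
    rw [hMq]
    rw [phi_im]
    apply mul_neg_of_pos_of_neg hy'
    have hn : 1 < normSq ((x:ℂ) + y * I) := by
      rw [normSq_add_mul_I]
      have := abs_mul_abs_self x
      nlinarith [sq_nonneg y]
    rw [sub_neg, div_lt_one (by linarith)]
    exact hn
  · have hφ : ∀ y : ℝ, 0 < y → -((y:ℂ) * I) - 1 / (y * I) = ((1 / y - y : ℝ) : ℂ) * I := by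
      intro y hy
      have : (y:ℂ) ≠ 0 := by exact_mod_cast hy.ne'
      push_cast
      field_simp
      simp
    have ht : Tendsto (fun y : ℝ => ((1 / y - y : ℝ) : ℂ) * I) (𝓝[>] 0) (cobounded ℂ) := by
      rw [← tendsto_norm_atTop_iff_cobounded]
      have h1 : Tendsto (fun y : ℝ => 1 / y - y) (𝓝[>] 0) atTop := by
        have h2 : Tendsto (fun y : ℝ => y⁻¹) (𝓝[>] 0) atTop := tendsto_inv_nhdsGT_zero
        have h3 : Tendsto (fun y : ℝ => -y) (𝓝[>] 0) (𝓝 (-0)) :=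
          (tendsto_id.mono_left nhdsWithin_le_nhds).neg
        refine (h2.atTop_add h3).congr fun y => by ring
      refine (tendsto_abs_atTop_atTop.comp h1).congr fun y => ?_
      simp only [Function.comp, norm_mul, norm_real, Complex.norm_I, mul_one, Real.norm_eq_abs]
    have h1 := hlim.comp ht
    have h2 : Tendsto (fun y : ℝ => -(((1:ℝ) - y ^ 2 : ℝ) : ℂ)) (𝓝[>] 0) (𝓝 (-1)) := by
      have : ContinuousAt (fun y : ℝ => -(((1:ℝ) - y ^ 2 : ℝ) : ℂ)) 0 := by fun_prop
      have := this.tendsto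
      simp at this
      refine (this.mono_left nhdsWithin_le_nhds).congr fun y => by simp
    have h3 := h1.div h2 (by norm_num)
    rw [div_self (by norm_num)] at h3
    refine h3.congr' ?_
    have hs : ∀ᶠ y : ℝ in 𝓝[>] 0, y < 1 := by
      apply Filter.Eventually.filter_mono nhdsWithin_le_nhds
      exact eventually_lt_nhds (by norm_num)
    filter_upwards [self_mem_nhdsWithin, hs] with y hy hy1
    have hy0 : (0:ℝ) < y := hy
    have hyc : (y:ℂ) ≠ 0 := by exact_mod_cast hy0.ne'
    have hq : (1:ℝ) - y ^ 2 ≠ 0 := by nlinarith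
    have hqc : (1:ℂ) - (y:ℂ) ^ 2 ≠ 0 := by exact_mod_cast hq
    rw [hFM _ (by simpa using hy0), hφ y hy0, hMp]
    · simp only [Function.comp, Pi.div_apply]
      push_cast
      field_simp
      simp
    · have : 0 < 1 / y - y := by
        rw [sub_pos, lt_div_iff₀ hy0]; nlinarith
      simpa using this


open Topology in
lemma decay (σ : Measure ℝ) [IsFiniteMeasure σ] (C : ℝ) (h : ℝ → ℝ) (hb : ∀ᵐ t ∂σ, |h t| ≤ C) :
    Tendsto (fun y : ℝ => ∫ t : ℝ, (h t : ℂ) * ((t:ℂ) - y * I)⁻¹ ∂σ) atTop (𝓝 0) := by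
  have hlim : Tendsto (fun y : ℝ => C * y⁻¹ * σ.real univ) atTop (𝓝 0) := by
    have := (tendsto_inv_atTop_zero (𝕜 := ℝ)).const_mul C |>.mul_const (σ.real univ)
    simpa using this
  refine squeeze_zero_norm' ?_ hlim
  filter_upwards [eventually_gt_atTop 0] with y hy
  apply norm_integral_le_of_norm_le_const
  filter_upwards [hb] with t ht
  rw [norm_mul, norm_inv, norm_real, Real.norm_eq_abs]
  have h1 : y ≤ ‖(t:ℂ) - y * I‖ := by
    have := abs_im_le_norm ((t:ℂ) - y * I)
    simp at this
    exact (le_abs_self y).trans this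
  gcongr
  exact (abs_nonneg _).trans ht

open Topology in
lemma moments_ext (σ σ' : Measure ℝ) [IsFiniteMeasure σ] [IsFiniteMeasure σ'] (C : ℝ)
    (hb : ∀ᵐ t ∂σ, |t| ≤ C) (hb' : ∀ᵐ t ∂σ', |t| ≤ C)
    (hm : ∀ n : ℕ, ∫ t : ℝ, t ^ n ∂σ = ∫ t : ℝ, t ^ n ∂σ') : σ = σ' := by
  have hIntg : ∀ (τ : Measure ℝ) [IsFiniteMeasure τ], (∀ᵐ t ∂τ, |t| ≤ C) → ∀ f : ℝ → ℝ, Continuous f →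
      Integrable f τ := by
    intro τ _ hτ f hf
    obtain ⟨D, hD⟩ := (isCompact_Icc (a := -C) (b := C)).exists_bound_of_continuousOn hf.continuousOn
    refine Integrable.of_bound (C := D) hf.aestronglyMeasurable ?_
    filter_upwards [hτ] with t ht
    exact hD t (abs_le.mp ht)
  have hpoly : ∀ P : Polynomial ℝ, ∫ t : ℝ, P.eval t ∂σ = ∫ t : ℝ, P.eval t ∂σ' := by
    intro P
    simp only [Polynomial.eval_eq_sum_range]
    rw [integral_finsetSum, integral_finsetSum]
    · apply Finset.sum_congr rfl
      intro n _
      rw [integral_const_mul, integral_const_mul, hm n]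
    · intro n _
      exact hIntg σ' hb' _ (by fun_prop)
    · intro n _
      exact hIntg σ hb _ (by fun_prop)
  apply ext_of_forall_integral_eq_of_IsFiniteMeasure
  intro f
  have hclose : ∀ ε > 0, |∫ t : ℝ, f t ∂σ - ∫ t : ℝ, f t ∂σ'| ≤ ε * (σ.real univ + σ'.real univ) := by
    intro ε hε
    obtain ⟨P, hP⟩ := exists_polynomial_near_of_continuousOn (-C) C f f.continuous.continuousOn ε hε
    have h1 : ∀ (τ : Measure ℝ) [IsFiniteMeasure τ], (∀ᵐ t ∂τ, |t| ≤ C) →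
        |∫ t : ℝ, f t ∂τ - ∫ t : ℝ, P.eval t ∂τ| ≤ ε * τ.real univ := by
      intro τ _ hτ
      rw [← integral_sub (hIntg τ hτ _ f.continuous) (hIntg τ hτ _ (by fun_prop))]
      rw [← Real.norm_eq_abs]
      apply norm_integral_le_of_norm_le_const
      filter_upwards [hτ] with t ht
      rw [norm_sub_rev]
      exact (hP t (abs_le.mp ht)).le
    have e1 := abs_le.mp (h1 σ hb)
    have e2 := abs_le.mp (h1 σ' hb')
    have e3 := hpoly P
    rw [abs_le]
    constructor <;> linarith [e1.1, e1.2, e2.1, e2.2]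
  by_contra hne
  have hpos : 0 < |∫ t : ℝ, f t ∂σ - ∫ t : ℝ, f t ∂σ'| := abs_pos.mpr (sub_ne_zero.mpr hne)
  set d := |∫ t : ℝ, f t ∂σ - ∫ t : ℝ, f t ∂σ'| with hd
  set m := σ.real univ + σ'.real univ with hmm
  have hm0 : 0 ≤ m := by positivity
  have := hclose (d / (2 * (m + 1))) (by positivity)
  have h2 : d / (2 * (m + 1)) * m ≤ d / 2 := by
    rw [div_mul_eq_mul_div, div_le_div_iff₀ (by positivity) (by norm_num)]
    nlinarith
  linarith

open Topology in
lemma stieltjes_unique (σ σ' : Measure ℝ) [IsFiniteMeasure σ] [IsFiniteMeasure σ'] (C : ℝ)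
    (hb : ∀ᵐ t ∂σ, |t| ≤ C) (hb' : ∀ᵐ t ∂σ', |t| ≤ C) (A B A' B' : ℂ)
    (h : ∀ l : ℂ, 0 < l.im → A + B * l + ∫ t : ℝ, ((t:ℂ) - l)⁻¹ ∂σ = A' + B' * l + ∫ t : ℝ, ((t:ℂ) - l)⁻¹ ∂σ') :
    σ = σ' := by
  have hpow : ∀ (τ : Measure ℝ), (∀ᵐ t ∂τ, |t| ≤ C) → ∀ n : ℕ, ∀ᵐ t ∂τ, |t ^ n| ≤ C ^ n := by
    intro τ hτ n
    filter_upwards [hτ] with t ht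
    rw [abs_pow]; gcongr
  have hintp : ∀ (τ : Measure ℝ) [IsFiniteMeasure τ], (∀ᵐ t ∂τ, |t| ≤ C) → ∀ n : ℕ,
      Integrable (fun t : ℝ => ((t ^ n : ℝ) : ℂ)) τ := by
    intro τ _ hτ n
    refine Integrable.of_bound (C := C ^ n) (by fun_prop) ?_
    filter_upwards [hpow τ hτ n] with t ht
    rwa [norm_real]
  have hints : ∀ (τ : Measure ℝ) [IsFiniteMeasure τ], (∀ᵐ t ∂τ, |t| ≤ C) → ∀ n : ℕ, ∀ l : ℂ, 0 < l.im →
      Integrable (fun t : ℝ => ((t ^ n : ℝ) : ℂ) * ((t:ℂ) - l)⁻¹) τ := by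
    intro τ _ hτ n l hl
    refine Integrable.of_bound (C := C ^ n * (l.im)⁻¹) (by fun_prop) ?_
    filter_upwards [hpow τ hτ n] with t ht
    rw [norm_mul, norm_inv, norm_real, Real.norm_eq_abs]
    have h1 : l.im ≤ ‖(t:ℂ) - l‖ := by
      have := abs_im_le_norm ((t:ℂ) - l)
      simp at this
      exact (le_abs_self _).trans this
    gcongr
    exact (abs_nonneg _).trans ht
  -- the linear parts agree
  have h0 : ∀ l : ℂ, 0 < l.im → ∫ t : ℝ, ((t:ℂ) - l)⁻¹ ∂σ = ∫ t : ℝ, ((t:ℂ) - l)⁻¹ ∂σ' := by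
    have d1 := decay σ 1 (fun _ => 1) (by simp)
    have d2 := decay σ' 1 (fun _ => 1) (by simp)
    have d3 : Tendsto (fun y : ℝ => (A - A') + (B - B') * (y * I)) atTop (𝓝 0) := by
      have := d2.sub d1
      rw [sub_zero] at this
      refine this.congr' ?_
      filter_upwards [eventually_gt_atTop 0] with y hy
      have := h (y * I) (by simpa using hy)
      simp only [ofReal_one, one_mul]
      linear_combination -this
    have d4 : Tendsto (fun y : ℝ => ((y:ℂ))⁻¹) atTop (𝓝 0) := by
      have := (continuous_ofReal.tendsto (0:ℝ)).comp (tendsto_inv_atTop_zero (𝕜 := ℝ))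
      simpa [Function.comp_def] using this
    have d5 : Tendsto (fun y : ℝ => (B - B') * I) atTop (𝓝 0) := by
      have := (d4.mul d3).sub (d4.mul_const (A - A'))
      simp only [mul_zero, zero_mul, sub_zero] at this
      refine this.congr' ?_
      filter_upwards [eventually_gt_atTop 0] with y hy
      have : (y:ℂ) ≠ 0 := by exact_mod_cast hy.ne'
      field_simp
      ring
    have hB : B - B' = 0 := by
      have := tendsto_nhds_unique d5 tendsto_const_nhds
      simpa using this.symm
    have hA : A - A' = 0 := by
      simp only [hB, zero_mul, add_zero] at d3
      exact (tendsto_nhds_unique d3 tendsto_const_nhds).symm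
    intro l hl
    have := h l hl
    linear_combination this - hA - l * hB
  have hstep : ∀ (τ : Measure ℝ) [IsFiniteMeasure τ], (∀ᵐ t ∂τ, |t| ≤ C) → ∀ n : ℕ, ∀ l : ℂ, 0 < l.im →
      ∫ t : ℝ, ((t ^ (n+1) : ℝ) : ℂ) * ((t:ℂ) - l)⁻¹ ∂τ =
        ((∫ t : ℝ, t ^ n ∂τ : ℝ) : ℂ) + l * ∫ t : ℝ, ((t ^ n : ℝ) : ℂ) * ((t:ℂ) - l)⁻¹ ∂τ := by
    intro τ _ hτ n l hl
    have e : ((∫ t : ℝ, t ^ n ∂τ : ℝ) : ℂ) = ∫ t : ℝ, ((t ^ n : ℝ) : ℂ) ∂τ := (integral_ofReal (𝕜 := ℂ)).symm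
    rw [← integral_const_mul, e, ← integral_add (hintp τ hτ n) ((hints τ hτ n l hl).const_mul l)]
    congr 1
    ext t
    have : (t:ℂ) - l ≠ 0 := by
      intro h; have := congrArg Complex.im h; simp at this; linarith
    field_simp
    push_cast
    ring
  have hconst : ∀ n : ℕ, (∀ l : ℂ, 0 < l.im → ∫ t : ℝ, ((t ^ n : ℝ) : ℂ) * ((t:ℂ) - l)⁻¹ ∂σ =
      ∫ t : ℝ, ((t ^ n : ℝ) : ℂ) * ((t:ℂ) - l)⁻¹ ∂σ') → ∫ t : ℝ, t ^ n ∂σ = ∫ t : ℝ, t ^ n ∂σ' := by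
    intro n hn
    have d1 := decay σ (C ^ (n+1)) (fun t => t ^ (n+1)) (hpow σ hb (n+1))
    have d2 := decay σ' (C ^ (n+1)) (fun t => t ^ (n+1)) (hpow σ' hb' (n+1))
    have d3 : Tendsto (fun y : ℝ => ((∫ t : ℝ, t ^ n ∂σ : ℝ) : ℂ) - ((∫ t : ℝ, t ^ n ∂σ' : ℝ) : ℂ)) atTop (𝓝 0) := by
      have := d1.sub d2
      rw [sub_zero] at this
      refine this.congr' ?_
      filter_upwards [eventually_gt_atTop 0] with y hy
      have hy' : 0 < ((y:ℂ) * I).im := by simpa using hy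
      rw [hstep σ hb n _ hy', hstep σ' hb' n _ hy', hn _ hy']
      ring
    have := tendsto_nhds_unique d3 tendsto_const_nhds
    have h2 := sub_eq_zero.mp this.symm
    exact_mod_cast h2
  have hall : ∀ n : ℕ, ∀ l : ℂ, 0 < l.im → ∫ t : ℝ, ((t ^ n : ℝ) : ℂ) * ((t:ℂ) - l)⁻¹ ∂σ =
      ∫ t : ℝ, ((t ^ n : ℝ) : ℂ) * ((t:ℂ) - l)⁻¹ ∂σ' := by
    intro n
    induction n with
    | zero =>
      intro l hl
      simpa using h0 l hl
    | succ n ih =>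
      intro l hl
      rw [hstep σ hb n l hl, hstep σ' hb' n l hl, ih l hl, hconst n ih]
  exact moments_ext σ σ' C hb hb' (fun n => hconst n (hall n))


lemma annulus_compact (r : ℝ) : IsCompact {t : ℝ | r ≤ |t| ∧ |t| ≤ 1 / r} := by
  apply Metric.isCompact_of_isClosed_isBounded
  · exact (isClosed_le continuous_const continuous_abs).inter (isClosed_le continuous_abs continuous_const)
  · refine (Metric.isBounded_Icc (-(1 / r)) (1 / r)).subset ?_
    intro t ht
    exact abs_le.mp ht.2

open Topology in
lemma rep_at_zero (r : ℝ) (hr0 : 0 < r) (F : ℂ → ℂ) (A B : ℝ) (σ : Measure ℝ) [IsFiniteMeasure σ]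
    (hσ : σ {t : ℝ | r ≤ |t| ∧ |t| ≤ 1 / r}ᶜ = 0)
    (hrep : ∀ l : ℂ, 0 < l.im → F l = A + B * l + ∫ t : ℝ, ((t:ℂ) - l)⁻¹ ∂σ)
    (h1 : Tendsto (fun y : ℝ => F (y * I) / (y * I)) (𝓝[>] 0) (𝓝 1)) :
    A = -(∫ t : ℝ, t⁻¹ ∂σ) ∧ B = 1 - ∫ t : ℝ, (t ^ 2)⁻¹ ∂σ := by
  have hd := stieltjes_hasDerivAt σ _ (annulus_compact r).isClosed hσ 0 (by
    rintro t ⟨h, -⟩ h0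
    have : t = 0 := by exact_mod_cast h0
    rw [this, abs_zero] at h
    linarith)
  have hy : Tendsto (fun y : ℝ => (y:ℂ) * I) (𝓝[>] 0) (𝓝[≠] 0) := by
    rw [tendsto_nhdsWithin_iff]
    constructor
    · have : Continuous (fun y : ℝ => (y:ℂ) * I) := by fun_prop
      have h2 := this.tendsto 0
      simp only [ofReal_zero, zero_mul] at h2
      exact h2.mono_left nhdsWithin_le_nhds
    · filter_upwards [self_mem_nhdsWithin] with y hy
      have : y ≠ 0 := (ne_of_gt hy)
      simp [this]
  have hy0 := hy.mono_right nhdsWithin_le_nhds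
  have hF0 : Tendsto (fun y : ℝ => F (y * I)) (𝓝[>] 0) (𝓝 0) := by
    have := h1.mul hy0
    rw [mul_zero] at this
    refine this.congr' ?_
    filter_upwards [self_mem_nhdsWithin] with y hy
    have : (y:ℂ) ≠ 0 := by exact_mod_cast (ne_of_gt hy)
    field_simp [I_ne_zero]
  have hpos : ∀ᶠ y : ℝ in 𝓝[>] 0, 0 < ((y:ℂ) * I).im := by
    filter_upwards [self_mem_nhdsWithin] with y hy
    simpa using hy
  have hF1 : Tendsto (fun y : ℝ => F (y * I)) (𝓝[>] 0)
      (𝓝 (A + B * 0 + ∫ t : ℝ, ((t:ℂ) - 0)⁻¹ ∂σ)) := by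
    have := ((hy0.const_mul (B:ℂ)).const_add (A:ℂ)).add (hd.continuousAt.tendsto.comp hy0)
    refine this.congr' ?_
    filter_upwards [hpos] with y hy
    rw [hrep _ hy]
    rfl
  have e0 := tendsto_nhds_unique hF0 hF1
  have e1 : ∫ t : ℝ, ((t:ℂ) - 0)⁻¹ ∂σ = ((∫ t : ℝ, t⁻¹ ∂σ : ℝ) : ℂ) := by
    rw [← integral_complex_ofReal]
    congr 1
    ext t
    simp
  have e2 : ∫ t : ℝ, (((t:ℂ) - 0)⁻¹) ^ 2 ∂σ = ((∫ t : ℝ, (t ^ 2)⁻¹ ∂σ : ℝ) : ℂ) := by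
    rw [← integral_complex_ofReal]
    congr 1
    ext t
    simp
  have hF2 : Tendsto (fun y : ℝ => F (y * I) / (y * I)) (𝓝[>] 0)
      (𝓝 (B + ∫ t : ℝ, (((t:ℂ) - 0)⁻¹) ^ 2 ∂σ)) := by
    have := ((hasDerivAt_iff_tendsto_slope_zero.mp hd).comp hy).const_add (B:ℂ)
    refine this.congr' ?_
    filter_upwards [hpos] with y hy
    have hne : (y:ℂ) * I ≠ 0 := by
      intro h; rw [h] at hy; simp at hy
    simp only [Function.comp_apply, smul_eq_mul, zero_add]
    rw [hrep _ hy]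
    have e00 : ∫ t : ℝ, ((t:ℂ) - 0)⁻¹ ∂σ = -(A:ℂ) := by linear_combination -e0
    rw [e00, inv_mul_eq_div, eq_div_iff hne, add_mul, div_mul_cancel₀ _ hne]
    ring
  have e3 := tendsto_nhds_unique h1 hF2
  rw [e2] at e3
  rw [e1] at e0
  constructor
  · have : (0:ℝ) = A + B * 0 + ∫ t : ℝ, t⁻¹ ∂σ := by exact_mod_cast e0
    linarith
  · have : (1:ℝ) = B + ∫ t : ℝ, (t ^ 2)⁻¹ ∂σ := by exact_mod_cast e3
    linarith

/-- solving `-x - 1/x = E` inside the disc of radius `r`. -/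
lemma solve_phi (R r : ℝ) (hr0 : 0 < r) (hr1 : r ≤ 1) (hrR : r + 1 / r = R) (E : ℝ) (hE : R < |E|) :
    ∃ x : ℝ, x ≠ 0 ∧ |x| < r ∧ -x - 1 / x = E ∧ 0 < E * (x - 1 / x) := by
  have key : ∀ E : ℝ, R < E → ∃ x : ℝ, 0 < x ∧ x < r ∧ x + 1 / x = E := by
    intro E hE
    have hR2 : 2 ≤ R := by
      rw [← hrR, show r + 1 / r = (r * r + 1) / r by field_simp, le_div_iff₀ hr0]
      nlinarith [sq_nonneg (r - 1)]
    have hrr : r * r - R * r + 1 = 0 := by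
      rw [← hrR]; field_simp; ring
    have hD : 0 ≤ E ^ 2 - 4 := by nlinarith
    have hs := Real.sq_sqrt hD
    have hs0 := Real.sqrt_nonneg (E ^ 2 - 4)
    set s := Real.sqrt (E ^ 2 - 4) with hsd
    have hsE : s < E := by nlinarith
    refine ⟨(E - s) / 2, by linarith, ?_, ?_⟩
    · by_contra hcon
      push Not at hcon
      -- r ≤ x ≤ E/2 : decreasing quadratic
      have hq : r * r - E * r + 1 < 0 := by nlinarith
      have hfac : (r - (E - s) / 2) * (r - (E + s) / 2) = r * r - E * r + 1 := by nlinarith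
      nlinarith [mul_nonneg (sub_nonneg.mpr hcon) (show (0:ℝ) ≤ (E + s) / 2 - r by linarith)]
    · have : (E - s) / 2 ≠ 0 := by
        have : 0 < (E - s) / 2 := by linarith
        exact this.ne'
      have hne : E - s ≠ 0 := by linarith [sub_pos.mpr hsE] |> fun h : 0 < E - s => h.ne'
      field_simp
      nlinarith
  have sgn : ∀ x : ℝ, 0 < x → x < r → 0 < 1 / x - x := by
    intro x h0 h1
    have : 1 < 1 / x := by rw [lt_div_iff₀ h0]; linarith
    linarith
  rcases le_or_gt 0 E with h | h
  · rw [abs_of_nonneg h] at hE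
    obtain ⟨x, h0, h1, h2⟩ := key E hE
    have hpos : 0 < E := by rw [← h2]; positivity
    refine ⟨-x, by linarith [h0] |> fun h : -x < 0 => h.ne, by rwa [abs_neg, abs_of_pos h0], ?_, ?_⟩
    · rw [← h2, one_div_neg_eq_neg_one_div]; ring
    · rw [one_div_neg_eq_neg_one_div]
      have := mul_pos hpos (sgn x h0 h1)
      linarith
  · rw [abs_of_neg h] at hE
    obtain ⟨x, h0, h1, h2⟩ := key (-E) hE
    refine ⟨x, h0.ne', by rwa [abs_of_pos h0], by linarith, ?_⟩
    have := mul_pos (neg_pos.mpr h) (sgn x h0 h1)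
    linarith

open Topology in
lemma rep_boundary (r : ℝ) (F : ℂ → ℂ) (A B : ℝ) (σ : Measure ℝ) [IsFiniteMeasure σ]
    (hσ : σ {t : ℝ | r ≤ |t| ∧ |t| ≤ 1 / r}ᶜ = 0)
    (hrep : ∀ l : ℂ, 0 < l.im → F l = A + B * l + ∫ t : ℝ, ((t:ℂ) - l)⁻¹ ∂σ)
    (x : ℝ) (hx : ¬ (r ≤ |x| ∧ |x| ≤ 1 / r)) (p : ℝ)
    (h : Tendsto (fun y : ℝ => F (x + y * I)) (𝓝[>] 0) (𝓝 (p : ℂ))) :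
    Integrable (fun t : ℝ => (t - x)⁻¹) σ ∧ p = A + B * x + ∫ t : ℝ, (t - x)⁻¹ ∂σ := by
  have hne : ∀ t ∈ {t : ℝ | r ≤ |t| ∧ |t| ≤ 1 / r}, (t:ℂ) ≠ (x:ℂ) := by
    intro t ht he
    have : t = x := by exact_mod_cast he
    rw [this] at ht
    exact hx ht
  have hd := stieltjes_hasDerivAt σ _ (annulus_compact r).isClosed hσ x hne
  have hi := stieltjes_integrable σ _ (annulus_compact r).isClosed hσ x hne
  have ei : (fun t : ℝ => ((t:ℂ) - x)⁻¹) = fun t : ℝ => (((t - x)⁻¹ : ℝ) : ℂ) := by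
    ext t; push_cast; rfl
  have hIntg : Integrable (fun t : ℝ => (t - x)⁻¹) σ := by
    rw [ei] at hi
    exact hi.re
  refine ⟨hIntg, ?_⟩
  have hy : Tendsto (fun y : ℝ => (x:ℂ) + (y:ℂ) * I) (𝓝[>] 0) (𝓝 x) := by
    have : Continuous (fun y : ℝ => (x:ℂ) + (y:ℂ) * I) := by fun_prop
    have h2 := this.tendsto 0
    simp only [ofReal_zero, zero_mul, add_zero] at h2
    exact h2.mono_left nhdsWithin_le_nhds
  have hF1 : Tendsto (fun y : ℝ => F (x + y * I)) (𝓝[>] 0)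
      (𝓝 (A + B * x + ∫ t : ℝ, ((t:ℂ) - x)⁻¹ ∂σ)) := by
    have := ((hy.const_mul (B:ℂ)).const_add (A:ℂ)).add (hd.continuousAt.tendsto.comp hy)
    refine this.congr' ?_
    filter_upwards [self_mem_nhdsWithin] with y hy
    rw [hrep _ (by simpa using hy)]
    rfl
  have e := tendsto_nhds_unique h hF1
  rw [ei, integral_complex_ofReal] at e
  exact_mod_cast e

open Topology in
lemma rep_positive (R r : ℝ) (hr0 : 0 < r) (hr1 : r ≤ 1) (hrR : r + 1 / r = R)
    (F : ℂ → ℂ) (A B : ℝ) (σ : Measure ℝ) [IsFiniteMeasure σ]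
    (hσ : σ {t : ℝ | r ≤ |t| ∧ |t| ≤ 1 / r}ᶜ = 0)
    (hrep : ∀ l : ℂ, 0 < l.im → F l = A + B * l + ∫ t : ℝ, ((t:ℂ) - l)⁻¹ ∂σ)
    (P Q : ℝ → ℝ) (hPQ : ∀ E, R < |E| → 0 < E * (P E + Q E))
    (hP : ∀ x : ℝ, x ≠ 0 → |x| < r →
      Tendsto (fun y : ℝ => F (x + y * I)) (𝓝[>] 0) (𝓝 (P (-x - 1 / x) : ℂ)))
    (hQ : ∀ x : ℝ, 1 / r < |x| →
      Tendsto (fun y : ℝ => F (x + y * I)) (𝓝[>] 0) (𝓝 (-(Q (-x - 1 / x)) : ℂ)))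
    (E : ℝ) (hE : R < |E|) :
    Integrable (fun t : ℝ => (t ^ 2 + E * t + 1)⁻¹) σ ∧
      0 < B + ∫ t : ℝ, (t ^ 2 + E * t + 1)⁻¹ ∂σ := by
  obtain ⟨x, hx0, hxr, hxE, hxs⟩ := solve_phi R r hr0 hr1 hrR E hE
  have hax : 0 < |x| := abs_pos.mpr hx0
  have hx1 : 1 / r < |1 / x| := by
    rw [abs_div, abs_one]
    exact one_div_lt_one_div_of_lt hax hxr
  have hE1 : -(1 / x) - 1 / (1 / x) = E := by
    rw [one_div_one_div, ← hxE]; ring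
  have t1 := hP x hx0 hxr
  have t2 := hQ (1 / x) hx1
  rw [hxE] at t1
  rw [hE1] at t2
  obtain ⟨i1, e1⟩ := rep_boundary r F A B σ hσ hrep x (fun h => by linarith [h.1]) (P E) t1
  obtain ⟨i2, e2⟩ := rep_boundary r F A B σ hσ hrep (1 / x) (fun h => by linarith [h.2]) (-Q E)
    (by push_cast at t2 ⊢; exact t2)
  have hae : ∀ᵐ t ∂σ, r ≤ |t| ∧ |t| ≤ 1 / r := hσ
  have hxx : x - 1 / x ≠ 0 := by
    intro h; rw [h] at hxs; simp at hxs
  have hpt : ∀ᵐ t ∂σ, (x - 1 / x)⁻¹ * ((t - x)⁻¹ - (t - 1 / x)⁻¹) = (t ^ 2 + E * t + 1)⁻¹ := by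
    filter_upwards [hae] with t ht
    have n1 : t - x ≠ 0 := by
      intro h
      have : t = x := by linarith
      rw [this] at ht; linarith [ht.1]
    have n2 : t - 1 / x ≠ 0 := by
      intro h
      have : t = 1 / x := by linarith
      rw [this] at ht; linarith [ht.2]
    have hfac : t ^ 2 + E * t + 1 = (t - x) * (t - 1 / x) := by
      rw [← hxE]; field_simp; ring
    rw [hfac, inv_sub_inv n1 n2, show t - 1 / x - (t - x) = x - 1 / x by ring, mul_div_assoc']
    rw [inv_mul_cancel₀ hxx, one_div]
  have i3 : Integrable (fun t : ℝ => (x - 1 / x)⁻¹ * ((t - x)⁻¹ - (t - 1 / x)⁻¹)) σ :=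
    (i1.sub i2).const_mul _
  refine ⟨i3.congr hpt, ?_⟩
  rw [← integral_congr_ae hpt, integral_const_mul, integral_sub i1 i2]
  have h3 := hPQ E hE
  have h4 : P E + Q E = (x - 1 / x) * (B + (x - 1 / x)⁻¹ * (∫ t : ℝ, (t - x)⁻¹ ∂σ - ∫ t : ℝ, (t - 1 / x)⁻¹ ∂σ)) := by
    rw [mul_add, mul_inv_cancel_left₀ hxx]
    linarith
  rw [h4, ← mul_assoc] at h3
  exact pos_of_mul_pos_right h3 hxs.le

lemma endpoint_mass (R r : ℝ) (hr0 : 0 < r) (hr1 : r ≤ 1) (hrR : r + 1 / r = R) (B : ℝ)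
    (σ : Measure ℝ) [IsFiniteMeasure σ]
    (hσ : σ {t : ℝ | r ≤ |t| ∧ |t| ≤ 1 / r}ᶜ = 0)
    (h : ∀ E : ℝ, R < |E| → Integrable (fun t : ℝ => (t ^ 2 + E * t + 1)⁻¹) σ ∧
      0 < B + ∫ t : ℝ, (t ^ 2 + E * t + 1)⁻¹ ∂σ) (t0 : ℝ) (ht0 : |t0| = r ∨ |t0| = 1 / r) :
    σ {t0} = 0 := by
  have hae : ∀ᵐ t ∂σ, r ≤ |t| ∧ |t| ≤ 1 / r := hσ
  have hrinv : 0 < 1 / r := by positivity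
  have hp0 : 0 < |t0| := by rcases ht0 with h | h <;> rw [h] <;> assumption
  have ht00 : t0 ≠ 0 := abs_pos.mp hp0
  have hR0 : 0 < R := by rw [← hrR]; positivity
  have hsum : |t0| + 1 / |t0| = R := by
    rcases ht0 with h | h <;> rw [h, ← hrR]
    rw [one_div_one_div]; ring
  have hq0 : |t0| ^ 2 - R * |t0| + 1 = 0 := by
    rw [← hsum]; field_simp; ring
  -- main inequality
  have main : ∀ η : ℝ, 0 < η → σ.real {t0} ≤ |t0| * η * (B + σ.real univ) := by
    intro η hη
    obtain ⟨s, hs, hst⟩ : ∃ s : ℝ, (s = 1 ∨ s = -1) ∧ s * t0 = |t0| := by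
      rcases le_or_gt 0 t0 with h | h
      · exact ⟨1, Or.inl rfl, by rw [abs_of_nonneg h]; ring⟩
      · exact ⟨-1, Or.inr rfl, by rw [abs_of_neg h]; ring⟩
    set E := -(s * (R + η)) with hEd
    have hE : R < |E| := by
      rw [hEd, abs_neg, abs_mul, abs_of_pos (by linarith : 0 < R + η)]
      rcases hs with h | h <;> rw [h] <;> norm_num <;> linarith
    obtain ⟨hi, hpos⟩ := h E hE
    have hval : t0 ^ 2 + E * t0 + 1 = -(|t0| * η) := by
      rw [hEd, ← sq_abs]
      linear_combination hq0 - (R + η) * hst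
    have hbound : ∀ᵐ t ∂σ, (t ^ 2 + E * t + 1)⁻¹ ≤
        1 + ({t0} : Set ℝ).indicator (fun _ => -(|t0| * η)⁻¹) t := by
      filter_upwards [hae] with t ht
      by_cases htt : t = t0
      · rw [htt, hval, indicator_of_mem (mem_singleton t0), inv_neg]
        linarith
      · rw [indicator_of_notMem (by simpa using htt), add_zero]
        by_cases hEt : 0 ≤ E * t
        · apply inv_le_one_of_one_le₀
          nlinarith [sq_nonneg t]
        · have hneg : t ^ 2 + E * t + 1 ≤ 0 := by
            have hEt' : E * t = -((R + η) * |t|) := by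
              have h1 : |E * t| = (R + η) * |t| := by
                rw [abs_mul, hEd, abs_neg, abs_mul, abs_of_pos (by linarith : 0 < R + η)]
                rcases hs with h | h <;> rw [h] <;> norm_num
              rw [abs_of_neg (not_le.mp hEt)] at h1
              linarith
            rw [hEt', ← sq_abs]
            have hfac : |t| ^ 2 - R * |t| + 1 = (|t| - r) * (|t| - 1 / r) := by
              rw [← hrR]; field_simp; ring
            have h2 : (|t| - r) * (|t| - 1 / r) ≤ 0 :=
              mul_nonpos_of_nonneg_of_nonpos (by linarith [ht.1]) (by linarith [ht.2])
            nlinarith [abs_nonneg t]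
          exact (inv_nonpos.mpr hneg).trans zero_le_one
    have hi2 : Integrable (fun t : ℝ => ({t0} : Set ℝ).indicator (fun _ => -(|t0| * η)⁻¹) t) σ :=
      (integrable_const _).indicator (measurableSet_singleton t0)
    have hle := integral_mono_ae hi ((integrable_const (1:ℝ)).add hi2) hbound
    have hcalc : ∫ t : ℝ, (1 + ({t0} : Set ℝ).indicator (fun _ => -(|t0| * η)⁻¹) t) ∂σ =
        σ.real univ + σ.real {t0} * -(|t0| * η)⁻¹ := by
      rw [integral_add (integrable_const _) hi2, integral_indicator (measurableSet_singleton t0), setIntegral_const,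
        integral_const, smul_eq_mul, smul_eq_mul, mul_one]
    have hle2 : ∫ t : ℝ, (t ^ 2 + E * t + 1)⁻¹ ∂σ ≤ σ.real univ + σ.real {t0} * -(|t0| * η)⁻¹ := by
      rw [← hcalc]; exact hle
    have hk : 0 < |t0| * η := mul_pos hp0 hη
    have h5 : σ.real {t0} * (|t0| * η)⁻¹ ≤ B + σ.real univ := by linarith
    rw [← div_eq_mul_inv, div_le_iff₀ hk] at h5
    linarith
  have hz : σ.real {t0} ≤ 0 := by
    set D := B + σ.real univ with hD
    by_contra hcon
    push Not at hcon
    have hDpos : 0 < D := by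
      have := main 1 one_pos
      rw [mul_one] at this
      exact pos_of_mul_pos_right (lt_of_lt_of_le hcon this) hp0.le
    have := main (σ.real {t0} / (2 * (|t0| * D))) (by positivity)
    have h6 : |t0| * (σ.real {t0} / (2 * (|t0| * D))) * D = σ.real {t0} / 2 := by
      field_simp
    linarith
  have hz2 : σ.real {t0} = 0 := le_antisymm hz measureReal_nonneg
  exact (measureReal_eq_zero_iff).mp hz2


/-- Theorem 3.1 (Marchenko parametrization, necessity and uniqueness): let `R ≥ 2`,
`r ∈ (0,1]` with `r + 1/r = R`, and let `J ∈ M_R` with `F` function `F`. Then there is a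
unique finite Borel measure `σ` supported in `(-1/r,-r) ∪ (r,1/r)` such that
`F(λ) = -σ₋₁ + (1-σ₋₂)λ + ∫ dσ(t)/(t-λ)` on `ℂ⁺` and
`1 - σ₋₂ + ∫ dσ(t)/(t² + Et + 1) > 0` whenever `|E| > R`. -/
theorem statement6 (R r : ℝ) (hR : 2 ≤ R) (hr0 : 0 < r) (hr1 : r ≤ 1)
    (hrR : r + 1/r = R) (a b : ℤ → ℝ) (hJ : MemMR R a b)
    (F : ℂ → ℂ) (hF : IsFFunction a b F) :
    ∃! σ : Measure ℝ, IsFiniteMeasure σ ∧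
      σ ((Set.Ioo (-(1/r)) (-r) ∪ Set.Ioo r (1/r))ᶜ) = 0 ∧
      (∀ l : ℂ, 0 < l.im →
        F l = (↑(-(∫ t : ℝ, t⁻¹ ∂σ)) : ℂ) + (↑(1 - ∫ t : ℝ, (t^2)⁻¹ ∂σ) : ℂ) * l +
          ∫ t : ℝ, ((t:ℂ) - l)⁻¹ ∂σ) ∧
      (∀ E : ℝ, R < |E| →
        0 < 1 - (∫ t : ℝ, (t^2)⁻¹ ∂σ) + ∫ t : ℝ, (t^2 + E*t + 1)⁻¹ ∂σ) := by
  classical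
  have _ := hR
  obtain ⟨hFd, hFpos, P, Q, hPQ, hP, hQ, h1⟩ := F_facts R r hr0 hr1 hrR a b hJ F hF
  have hbd : ∀ x ∉ {t : ℝ | r ≤ |t| ∧ |t| ≤ 1 / r},
      Tendsto (fun y : ℝ => (F (x + y * I)).im) (nhdsWithin 0 (Set.Ioi 0)) (nhds 0) := by
    intro x hx
    have real_lim : ∀ p : ℝ, Tendsto (fun y : ℝ => F (x + y * I)) (nhdsWithin 0 (Set.Ioi 0)) (nhds (p : ℂ)) →
        Tendsto (fun y : ℝ => (F (x + y * I)).im) (nhdsWithin 0 (Set.Ioi 0)) (nhds 0) := by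
      intro p hp
      have := (continuous_im.tendsto (p : ℂ)).comp hp
      simpa [Function.comp_def] using this
    by_cases hx0 : x = 0
    · apply real_lim 0
      have hy0 : Tendsto (fun y : ℝ => (y:ℂ) * I) (nhdsWithin 0 (Set.Ioi 0)) (nhds 0) := by
        have : Continuous (fun y : ℝ => (y:ℂ) * I) := by fun_prop
        have h2 := this.tendsto 0
        simp only [ofReal_zero, zero_mul] at h2
        exact h2.mono_left nhdsWithin_le_nhds
      have := h1.mul hy0
      rw [mul_zero] at this
      rw [ofReal_zero]
      refine this.congr' ?_
      filter_upwards [self_mem_nhdsWithin] with y hy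
      have : (y:ℂ) ≠ 0 := by exact_mod_cast (ne_of_gt hy)
      rw [div_mul_cancel₀ _ (mul_ne_zero this I_ne_zero), hx0, ofReal_zero, zero_add]
    · by_cases hxr : |x| < r
      · exact real_lim _ (hP x hx0 hxr)
      · have hxr2 : 1 / r < |x| := by
          by_contra hcon
          exact hx ⟨not_lt.mp hxr, not_lt.mp hcon⟩
        apply real_lim (-(Q (-x - 1 / x)))
        have := hQ x hxr2
        push_cast at this ⊢
        exact this
  obtain ⟨A, B, σ, hfin, hσ, hrep⟩ :=
    herglotz_rep F hFd (fun z hz => (hFpos z hz).le) _ (annulus_compact r) hbd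
  obtain ⟨hA, hB⟩ := rep_at_zero r hr0 F A B σ hσ hrep h1
  have hpos := rep_positive R r hr0 hr1 hrR F A B σ hσ hrep P Q hPQ hP hQ
  have hmass := endpoint_mass R r hr0 hr1 hrR B σ hσ hpos
  have hrinv : 0 < 1 / r := by positivity
  refine ⟨σ, ⟨hfin, ?_, ?_, ?_⟩, ?_⟩
  · have hsub : (Set.Ioo (-(1/r)) (-r) ∪ Set.Ioo r (1/r))ᶜ ⊆
        {t : ℝ | r ≤ |t| ∧ |t| ≤ 1 / r}ᶜ ∪ (({r} ∪ {-r}) ∪ ({1 / r} ∪ {-(1 / r)})) := by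
      intro t ht
      by_contra hcon
      simp only [mem_union, mem_compl_iff, mem_singleton_iff, not_or, not_not, Set.mem_ofPred_eq] at hcon
      obtain ⟨⟨g1, g2⟩, ⟨g3, g4⟩, ⟨g5, g6⟩⟩ := hcon
      apply ht
      rcases le_or_gt 0 t with h | h
      · rw [abs_of_nonneg h] at g1 g2
        exact Or.inr ⟨lt_of_le_of_ne g1 (Ne.symm g3), lt_of_le_of_ne g2 g5⟩
      · rw [abs_of_neg h] at g1 g2
        refine Or.inl ⟨lt_of_le_of_ne (by linarith) (Ne.symm g6), lt_of_le_of_ne (by linarith) g4⟩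
    refine measure_mono_null hsub ?_
    refine measure_union_null hσ (measure_union_null (measure_union_null ?_ ?_) (measure_union_null ?_ ?_))
    · exact hmass _ (Or.inl (abs_of_pos hr0))
    · exact hmass _ (Or.inl (by rw [abs_neg, abs_of_pos hr0]))
    · exact hmass _ (Or.inr (abs_of_pos hrinv))
    · exact hmass _ (Or.inr (by rw [abs_neg, abs_of_pos hrinv]))
  · intro l hl
    rw [← hA, ← hB]
    exact hrep l hl
  · intro E hE
    rw [← hB]
    exact (hpos E hE).2
  · rintro τ ⟨hτf, hτs, hτr, -⟩
    have hbσ : ∀ᵐ t ∂σ, |t| ≤ 1 / r := by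
      have hae : ∀ᵐ t ∂σ, r ≤ |t| ∧ |t| ≤ 1 / r := hσ
      filter_upwards [hae] with t ht using ht.2
    have hbτ : ∀ᵐ t ∂τ, |t| ≤ 1 / r := by
      have hae : ∀ᵐ t ∂τ, t ∈ Set.Ioo (-(1/r)) (-r) ∪ Set.Ioo r (1/r) := hτs
      filter_upwards [hae] with t ht
      rw [abs_le]
      rcases ht with ⟨g1, g2⟩ | ⟨g1, g2⟩ <;> constructor <;> linarith
    refine stieltjes_unique τ σ (1 / r) hbτ hbσ _ _ _ _
      (fun l hl => (hτr l hl).symm.trans (hrep l hl))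
end
end
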